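/- arXiv:math/0202215 — 5 statements merged into one kernel-verified Lean document; each statement's English description precedes it below -/
import Mathlib

section
/- Suppose the system (φ₁,…,φₙ) satisfies the open convex set condition and every rotation angle αᵢ is commensurable with π (i.e., αᵢ/π ∈ ℚ for each i). Then K̃ = convexHull ℝ K has only finitely many sides: the set frontier K̃ \ (extremePoints ℝ K̃) has finitely many connected components. -/
open Set

open scoped ComplexConjugate

/-- A space covered by finitely many preconnected subsets has finitely many components. -/
theorem finite_connectedComponents_of_iUnion {X ι : Type*} [TopologicalSpace X] [Finite ι]
    {S : Set X} (C : ι → Set X) (hC : ∀ i, IsPreconnected (C i)) (hS : S = ⋃ i, C i) :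
    Finite (ConnectedComponents S) := by
  have hex : ∀ c : ConnectedComponents S, ∃ i, ∃ x : S, (x : ConnectedComponents S) = c ∧
      (x : X) ∈ C i := by
    intro c
    obtain ⟨x, rfl⟩ := ConnectedComponents.surjective_coe c
    obtain ⟨i, hi⟩ := mem_iUnion.1 (hS ▸ x.2 : (x : X) ∈ ⋃ i, C i)
    exact ⟨i, x, rfl, hi⟩
  choose g x hx hxg using hex
  refine Finite.of_injective g fun c d hcd => ?_
  rw [← hx c, ← hx d, ConnectedComponents.coe_eq_coe']
  have hpre : IsPreconnected ((↑) ⁻¹' C (g c) : Set S) := by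
    rw [← Topology.IsInducing.subtypeVal.isPreconnected_image, Subtype.image_preimage_coe,
      inter_eq_right.2 (hS ▸ subset_iUnion C (g c))]
    exact hC _
  exact hpre.subset_connectedComponent (by rw [hcd]; exact hxg d) (hxg c)

/-- In finite dimension, the convex hull of a compact set is compact. -/
theorem isCompact_convexHull_of_isCompact {E : Type*} [NormedAddCommGroup E] [NormedSpace ℝ E]
    [FiniteDimensional ℝ E] {K : Set E} (hK : IsCompact K) : IsCompact (convexHull ℝ K) := by
  rcases K.eq_empty_or_nonempty with rfl | ⟨k, hk⟩
  · simp
  let N := Module.finrank ℝ E + 1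
  have hcomp : IsCompact ((fun p : (Fin N → ℝ) × (Fin N → E) => ∑ i, p.1 i • p.2 i) ''
      (stdSimplex ℝ (Fin N) ×ˢ univ.pi fun _ => K)) :=
    ((isCompact_stdSimplex ℝ (Fin N)).prod (isCompact_univ_pi fun _ => hK)).image (by fun_prop)
  convert hcomp using 1
  refine Subset.antisymm (fun x hx => ?_) ?_
  · obtain ⟨ι, _, z, w, hz, hind, hw, hw1, rfl⟩ := eq_pos_convex_span_of_mem_convexHull hx
    obtain ⟨g⟩ : Nonempty (ι ↪ Fin N) := Function.Embedding.nonempty_of_card_le (by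
      rw [Fintype.card_fin]
      exact hind.card_le_finrank_succ.trans (Nat.add_le_add_right (Submodule.finrank_le _) 1))
    obtain ⟨W, hW, hW0⟩ : ∃ W : Fin N → ℝ, (∀ i, W (g i) = w i) ∧ ∀ j, j ∉ range g → W j = 0 :=
      ⟨Function.extend g w fun _ => 0, g.injective.extend_apply w _,
        fun j hj => Function.extend_apply' w _ j hj⟩
    obtain ⟨Z, hZ, hZ0⟩ : ∃ Z : Fin N → E, (∀ i, Z (g i) = z i) ∧ ∀ j, j ∉ range g → Z j = k :=
      ⟨Function.extend g z fun _ => k, g.injective.extend_apply z _,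
        fun j hj => Function.extend_apply' z _ j hj⟩
    refine ⟨(W, Z), ⟨⟨fun j => ?_, ?_⟩, fun j _ => ?_⟩, ?_⟩
    · by_cases hj : j ∈ range g
      · obtain ⟨i, rfl⟩ := hj
        exact (hw i).le.trans_eq (hW i).symm
      · exact (hW0 j hj).ge
    · rw [← hw1]
      exact (Fintype.sum_of_injective g g.injective _ _ hW0 fun i => (hW i).symm).symm
    · by_cases hj : j ∈ range g
      · obtain ⟨i, rfl⟩ := hj
        simpa only [hZ] using hz (mem_range_self i)
      · simpa only [hZ0 j hj] using hk
    · refine (Fintype.sum_of_injective g g.injective _ _ (fun j hj => ?_) fun i => ?_).symm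
      · simp only [hW0 j hj, zero_smul]
      · simp only [hW, hZ]
  · rintro _ ⟨⟨w, z⟩, ⟨hw, hz⟩, rfl⟩
    exact (convex_convexHull ℝ K).sum_mem (fun i _ => hw.1 i) hw.2
      fun i _ => subset_convexHull ℝ K (hz i (mem_univ i))

/-- Removing extreme points of a convex set from a convex subset leaves a convex set. -/
theorem Convex.diff_extremePoints {E : Type*} [AddCommGroup E] [Module ℝ E] {H F : Set E}
    (hF : Convex ℝ F) (hFH : F ⊆ H) : Convex ℝ (F \ H.extremePoints ℝ) := by
  rw [convex_iff_openSegment_subset]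
  intro x hx y hy z hz
  rcases eq_or_ne x y with rfl | hxy
  · rw [openSegment_same] at hz
    exact hz ▸ hx
  refine ⟨hF.openSegment_subset hx.1 hy.1 hz, fun hze => hxy ?_⟩
  obtain ⟨h₁, h₂⟩ := (mem_extremePoints.1 hze).2 x (hFH hx.1) y (hFH hy.1) hz
  exact h₁.trans h₂.symm

/-- The points of `S` at which the functional `z ↦ re (conj u * z)` is maximal on `S`. -/
def supportFace (S : Set ℂ) (u : ℂ) : Set ℂ :=
  {x | x ∈ S ∧ ∀ y ∈ S, (conj u * y).re ≤ (conj u * x).re}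

theorem convex_supportFace {S : Set ℂ} (hS : Convex ℝ S) (u : ℂ) :
    Convex ℝ (supportFace S u) := by
  intro x hx y hy a b ha hb hab
  refine ⟨hS hx.1 hy.1 ha hb hab, fun z hz => ?_⟩
  have h₁ := hx.2 z hz
  have h₂ := hy.2 z hz
  have h₃ : (conj u * (a • x + b • y)).re = a * (conj u * x).re + b * (conj u * y).re := by
    simp; ring
  have h₄ : (conj u * z).re = a * (conj u * z).re + b * (conj u * z).re := by
    rw [← add_mul, hab, one_mul]
  rw [h₃, h₄]
  gcongr

theorem supportFace_eq_of_mem {S : Set ℂ} {u x y : ℂ} (hx : x ∈ supportFace S u)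
    (hy : y ∈ supportFace S u) : (conj u * x).re = (conj u * y).re :=
  le_antisymm (hy.2 x hx.1) (hx.2 y hy.1)

theorem re_conj_mul_self_of_norm_eq_one {u : ℂ} (hu : ‖u‖ = 1) :
    u.re * u.re + u.im * u.im = 1 := by
  rw [← Complex.normSq_apply, Complex.normSq_eq_norm_sq, hu, one_pow]

theorem notMem_interior_of_mem_supportFace {S : Set ℂ} {u x : ℂ} (hu : ‖u‖ = 1)
    (hx : x ∈ supportFace S u) : x ∉ interior S := by
  intro hxi
  have hlim : Filter.Tendsto (fun t : ℝ => x + t * u) (nhdsWithin 0 (Ioi 0)) (nhds x) := by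
    have : Continuous fun t : ℝ => x + t * u := by fun_prop
    simpa using (this.tendsto 0).mono_left nhdsWithin_le_nhds
  obtain ⟨t, ht, ht0⟩ := ((hlim.eventually (mem_interior_iff_mem_nhds.1 hxi)).and
    self_mem_nhdsWithin).exists
  have h := hx.2 _ ht
  have h₁ := re_conj_mul_self_of_norm_eq_one hu
  have h₂ : (conj u * (x + t * u)).re = (conj u * x).re + t * (u.re * u.re + u.im * u.im) := by
    simp; ring
  rw [h₂, h₁] at h
  have : 0 < t := ht0
  linarith

theorem exists_eq_re_conj_mul (f : ℂ →L[ℝ] ℝ) : ∃ v : ℂ, ∀ z, f z = (conj v * z).re := by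
  refine ⟨⟨f 1, f Complex.I⟩, fun z => ?_⟩
  have h : z = z.re • (1 : ℂ) + z.im • Complex.I := by
    simp
  conv_lhs => rw [h, map_add, map_smul, map_smul]
  simp
  ring

/-- Every boundary point of a planar convex body lies in a support face. -/
theorem exists_mem_supportFace {H : Set ℂ} (hH : Convex ℝ H) (hHi : (interior H).Nonempty)
    {x : ℂ} (hxH : x ∈ H) (hx : x ∉ interior H) : ∃ u : ℂ, ‖u‖ = 1 ∧ x ∈ supportFace H u := by
  obtain ⟨f, hf⟩ := geometric_hahn_banach_open_point hH.interior isOpen_interior hx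
  obtain ⟨v, hv⟩ := exists_eq_re_conj_mul f
  have hfle : ∀ y ∈ H, f y ≤ f x := by
    intro y hy
    have hy' : y ∈ closure (interior H) := by
      rw [hH.closure_interior_eq_closure_of_nonempty_interior hHi]
      exact subset_closure hy
    exact closure_minimal (t := {y | f y ≤ f x}) (fun z hz => (hf z hz).le)
      (isClosed_le f.continuous continuous_const) hy'
  have hv0 : v ≠ 0 := by
    rintro rfl
    obtain ⟨y, hy⟩ := hHi
    have := hf y hy
    simp [hv] at this
  have hn : 0 < ‖v‖ := norm_pos_iff.2 hv0
  refine ⟨(‖v‖⁻¹ : ℝ) * v, ?_, hxH, fun y hy => ?_⟩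
  · rw [norm_mul, Complex.norm_real, norm_inv, norm_norm, inv_mul_cancel₀ hn.ne']
  · have h := hfle y hy
    rw [hv, hv] at h
    simp only [map_mul, Complex.conj_ofReal, mul_assoc, Complex.re_ofReal_mul]
    gcongr

/-- A ray from an interior point of a convex set meets the boundary at most once. -/
theorem subsingleton_ray_inter_boundary {H : Set ℂ} (hH : Convex ℝ H) {w : ℂ}
    (hw : w ∈ interior H) (d : ℂ) :
    {p | ∃ t : ℝ, 0 < t ∧ p = w + t * d ∧ p ∈ H ∧ p ∉ interior H}.Subsingleton := by
  have key : ∀ s t : ℝ, 0 < s → s < t → w + t * d ∈ H → w + s * d ∈ interior H := by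
    intro s t hs hst ht
    have ht0 : 0 < t := hs.trans hst
    refine hH.openSegment_interior_self_subset_interior hw ht
      ⟨1 - s / t, s / t, sub_pos.2 ((div_lt_one ht0).2 hst), by positivity, by ring, ?_⟩
    have : (t : ℂ) ≠ 0 := by exact_mod_cast ht0.ne'
    simp only [Complex.real_smul]
    push_cast
    field_simp
    ring
  rintro _ ⟨s, hs, rfl, hsH, hsi⟩ _ ⟨t, ht, rfl, htH, hti⟩
  rcases lt_trichotomy s t with h | rfl | h
  · exact absurd (key s t hs h htH) hsi
  · rfl
  · exact absurd (key t s ht h hsH) hti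

/-- A line through an interior point of a convex set meets the boundary at finitely many points. -/
theorem finite_line_inter_boundary {H : Set ℂ} (hH : Convex ℝ H) {v w : ℂ} (hv : v ≠ 0)
    (hw : w ∈ interior H) :
    {p | p ∈ H ∧ p ∉ interior H ∧ (conj v * p).re = (conj v * w).re}.Finite := by
  refine ((subsingleton_ray_inter_boundary hH hw (Complex.I * v)).finite.union
    (subsingleton_ray_inter_boundary hH hw (-(Complex.I * v))).finite).subset ?_
  rintro p ⟨hpH, hpi, hp⟩
  have hn : v.re ^ 2 + v.im ^ 2 ≠ 0 := by
    have := Complex.normSq_pos.2 hv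
    rw [Complex.normSq_apply] at this
    nlinarith
  obtain ⟨t, ht⟩ : ∃ t : ℝ, p = w + t * (Complex.I * v) := by
    refine ⟨((p - w).im * v.re - (p - w).re * v.im) / (v.re ^ 2 + v.im ^ 2), ?_⟩
    simp only [Complex.mul_re, Complex.conj_re, Complex.conj_im] at hp
    apply Complex.ext
    · simp only [Complex.add_re, Complex.mul_re, Complex.mul_im, Complex.I_re,
        Complex.ofReal_re, Complex.ofReal_im,
        Complex.I_im, Complex.sub_re, Complex.sub_im]
      field_simp
      linear_combination v.re * hp
    · simp only [Complex.add_im, Complex.mul_re, Complex.mul_im, Complex.I_re,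
        Complex.ofReal_re, Complex.ofReal_im,
        Complex.I_im, Complex.sub_re, Complex.sub_im]
      field_simp
      linear_combination v.im * hp
  rcases lt_trichotomy t 0 with h | rfl | h
  · exact Or.inr ⟨-t, neg_pos.2 h, by rw [ht]; push_cast; ring, hpH, hpi⟩
  · exact absurd (by simpa [ht] using hw) hpi
  · exact Or.inl ⟨t, h, ht, hpH, hpi⟩

/-- Two support faces through `p` that extend from `p` to the same side coincide. -/
theorem supportFace_direction_unique {H : Set ℂ} (hHi : (interior H).Nonempty) {p u₁ u₂ : ℂ}
    {r₁ r₂ : ℝ} (hr : 0 < r₁ * r₂) (hu₁ : ‖u₁‖ = 1) (hu₂ : ‖u₂‖ = 1)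
    (h₁ : p ∈ supportFace H u₁) (h₂ : p ∈ supportFace H u₂)
    (hy₁ : p + r₁ * (Complex.I * u₁) ∈ H) (hy₂ : p + r₂ * (Complex.I * u₂) ∈ H) : u₁ = u₂ := by
  have n₁ := re_conj_mul_self_of_norm_eq_one hu₁
  have n₂ := re_conj_mul_self_of_norm_eq_one hu₂
  have a₁ := h₂.2 _ hy₁
  have a₂ := h₁.2 _ hy₂
  have e₁ : (conj u₂ * (p + r₁ * (Complex.I * u₁))).re
      = (conj u₂ * p).re + r₁ * (u₁.re * u₂.im - u₁.im * u₂.re) := by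
    simp; ring
  have e₂ : (conj u₁ * (p + r₂ * (Complex.I * u₂))).re
      = (conj u₁ * p).re - r₂ * (u₁.re * u₂.im - u₁.im * u₂.re) := by
    simp; ring
  rw [e₁] at a₁
  rw [e₂] at a₂
  have hD : u₁.re * u₂.im - u₁.im * u₂.re = 0 := by
    by_contra hD
    have hD2 : 0 < (u₁.re * u₂.im - u₁.im * u₂.re) ^ 2 := by positivity
    have := mul_pos hr hD2
    nlinarith
  set s := u₁.re * u₂.re + u₁.im * u₂.im with hs
  have hre : u₁.re = s * u₂.re := by
    rw [hs]; linear_combination u₂.im * hD - u₁.re * n₂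
  have him : u₁.im = s * u₂.im := by
    rw [hs]; linear_combination -u₂.re * hD - u₁.im * n₂
  have hs2 : s * s = 1 := by
    rw [hre, him] at n₁
    linear_combination n₁ - s * s * n₂
  rcases mul_self_eq_one_iff.1 hs2 with h | h
  · rw [h] at hre him
    exact Complex.ext (by linarith) (by linarith)
  · exfalso
    rw [h] at hre him
    obtain ⟨w, hw⟩ := hHi
    refine notMem_interior_of_mem_supportFace hu₁ ⟨interior_subset hw, fun y hy => ?_⟩ hw
    have b₁ := h₁.2 y hy
    have b₂ := h₂.2 w (interior_subset hw)
    simp only [Complex.mul_re, Complex.conj_re, Complex.conj_im, hre, him] at b₁ b₂ ⊢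
    linarith

/-- A point of a planar convex body lies in finitely many nontrivial support faces. -/
theorem finite_nontrivial_supportFace_through {H : Set ℂ} (hHi : (interior H).Nonempty) (p : ℂ) :
    {u | ‖u‖ = 1 ∧ p ∈ supportFace H u ∧ (supportFace H u).Nontrivial}.Finite := by
  have hpos : {u | ‖u‖ = 1 ∧ p ∈ supportFace H u ∧
      ∃ r : ℝ, 0 < r ∧ p + r * (Complex.I * u) ∈ H}.Subsingleton := by
    rintro u₁ ⟨hu₁, h₁, r₁, hr₁, hy₁⟩ u₂ ⟨hu₂, h₂, r₂, hr₂, hy₂⟩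
    exact supportFace_direction_unique hHi (mul_pos hr₁ hr₂) hu₁ hu₂ h₁ h₂ hy₁ hy₂
  have hneg : {u | ‖u‖ = 1 ∧ p ∈ supportFace H u ∧
      ∃ r : ℝ, r < 0 ∧ p + r * (Complex.I * u) ∈ H}.Subsingleton := by
    rintro u₁ ⟨hu₁, h₁, r₁, hr₁, hy₁⟩ u₂ ⟨hu₂, h₂, r₂, hr₂, hy₂⟩
    exact supportFace_direction_unique hHi (mul_pos_of_neg_of_neg hr₁ hr₂) hu₁ hu₂ h₁ h₂ hy₁ hy₂
  refine (hpos.finite.union hneg.finite).subset ?_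
  rintro u ⟨hu, hp, hnt⟩
  obtain ⟨y, hy, hyp⟩ := hnt.exists_ne p
  have n := re_conj_mul_self_of_norm_eq_one hu
  have he := supportFace_eq_of_mem hy hp
  simp only [Complex.mul_re, Complex.conj_re, Complex.conj_im] at he
  obtain ⟨r, hr⟩ : ∃ r : ℝ, p + r * (Complex.I * u) = y := by
    refine ⟨(y - p).im * u.re - (y - p).re * u.im, ?_⟩
    apply Complex.ext
    · simp only [Complex.add_re, Complex.mul_re, Complex.mul_im, Complex.I_re,
        Complex.ofReal_re, Complex.ofReal_im,
        Complex.I_im, Complex.sub_re, Complex.sub_im]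
      linear_combination (y.re - p.re) * n - u.re * he
    · simp only [Complex.add_im, Complex.mul_re, Complex.mul_im, Complex.I_re,
        Complex.ofReal_re, Complex.ofReal_im,
        Complex.I_im, Complex.sub_re, Complex.sub_im]
      linear_combination (y.im - p.im) * n - u.im * he
  rcases lt_trichotomy r 0 with h | rfl | h
  · exact Or.inr ⟨hu, hp, r, h, hr ▸ hy.1⟩
  · exact absurd (by simpa using hr.symm) hyp
  · exact Or.inl ⟨hu, hp, r, h, hr ▸ hy.1⟩

/-- A segment whose ends lie on different sides of a line meets the line. -/
theorem exists_mem_segment_eq (v : ℂ) {c : ℝ} {a b : ℂ} (ha : (conj v * a).re ≤ c)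
    (hb : c ≤ (conj v * b).re) : ∃ p ∈ segment ℝ a b, (conj v * p).re = c := by
  have hcont : ContinuousOn (fun z : ℂ => (conj v * z).re) (segment ℝ a b) := by fun_prop
  exact (convex_segment a b).isPreconnected.intermediate_value (left_mem_segment ℝ a b)
    (right_mem_segment ℝ a b) hcont ⟨ha, hb⟩

/-- If two subbodies of a planar convex body have disjoint interiors, only finitely many nontrivial
support faces of the body meet both of them. -/
theorem finite_supportFace_meeting_both {H A B : Set ℂ} (hH : Convex ℝ H) (hA : Convex ℝ A)
    (hB : Convex ℝ B) (hAH : A ⊆ H) (hBH : B ⊆ H) (hAi : (interior A).Nonempty)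
    (hBi : (interior B).Nonempty) (hAB : Disjoint (interior A) (interior B)) :
    {u | ‖u‖ = 1 ∧ (supportFace H u).Nontrivial ∧ (supportFace H u ∩ A).Nonempty ∧
      (supportFace H u ∩ B).Nonempty}.Finite := by
  obtain ⟨f, c, hfA, hfB⟩ := geometric_hahn_banach_open_open hA.interior isOpen_interior
    hB.interior isOpen_interior hAB
  obtain ⟨v, hv⟩ := exists_eq_re_conj_mul f
  obtain ⟨a₀, ha₀⟩ := hAi
  obtain ⟨b₀, hb₀⟩ := hBi
  have hv0 : v ≠ 0 := by
    rintro rfl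
    have h₁ := hfA a₀ ha₀
    have h₂ := hfB b₀ hb₀
    simp only [hv, map_zero, zero_mul, Complex.zero_re] at h₁ h₂
    linarith
  have hfA' : ∀ z ∈ A, (conj v * z).re ≤ c := fun z hz => by
    rw [← hv]
    refine closure_minimal (t := {y | f y ≤ c}) (fun z hz => (hfA z hz).le)
      (isClosed_le f.continuous continuous_const) ?_
    rw [hA.closure_interior_eq_closure_of_nonempty_interior ⟨a₀, ha₀⟩]
    exact subset_closure hz
  have hfB' : ∀ z ∈ B, c ≤ (conj v * z).re := fun z hz => by
    rw [← hv]
    refine closure_minimal (t := {y | c ≤ f y}) (fun z hz => (hfB z hz).le)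
      (isClosed_le continuous_const f.continuous) ?_
    rw [hB.closure_interior_eq_closure_of_nonempty_interior ⟨b₀, hb₀⟩]
    exact subset_closure hz
  obtain ⟨w, hw, hwc⟩ := exists_mem_segment_eq v (hfA' a₀ (interior_subset ha₀))
    (hfB' b₀ (interior_subset hb₀))
  have hwi : w ∈ interior H :=
    hH.interior.segment_subset (interior_mono hAH ha₀) (interior_mono hBH hb₀) hw
  refine ((finite_line_inter_boundary hH hv0 hwi).biUnion
    fun p _ => finite_nontrivial_supportFace_through ⟨w, hwi⟩ p).subset ?_
  rintro u ⟨hu, hnt, ⟨a, haF, haA⟩, ⟨b, hbF, hbB⟩⟩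
  obtain ⟨p, hp, hpc⟩ := exists_mem_segment_eq v (hfA' a haA) (hfB' b hbB)
  have hpF := (convex_supportFace hH u).segment_subset haF hbF hp
  exact mem_biUnion (x := p)
    ⟨hpF.1, notMem_interior_of_mem_supportFace hu hpF, hpc.trans hwc.symm⟩ ⟨hu, hpF, hnt⟩

theorem supportFace_subset_supportFace_convexHull (K : Set ℂ) (u : ℂ) :
    supportFace K u ⊆ supportFace (convexHull ℝ K) u := by
  refine fun x hx => ⟨subset_convexHull ℝ K hx.1, fun y hy => ?_⟩
  refine convexHull_min (t := {y | (conj u * y).re ≤ (conj u * x).re}) hx.2 ?_ hy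
  exact convex_halfSpace_le (f := fun z : ℂ => (conj u * z).re)
    ⟨fun a b => by simp; ring, fun c a => by simp; ring⟩ _

theorem nonempty_supportFace {K : Set ℂ} (hKc : IsCompact K) (hKne : K.Nonempty) (u : ℂ) :
    (supportFace K u).Nonempty := by
  obtain ⟨x, hx, hmax⟩ := hKc.exists_isMaxOn hKne
    (f := fun z : ℂ => (conj u * z).re) (by fun_prop)
  exact ⟨x, hx, hmax⟩

/-- A nontrivial support face of the convex hull of `K` contains two points of `K`. -/
theorem nontrivial_supportFace_of_convexHull {K : Set ℂ} (hKc : IsCompact K) (hKne : K.Nonempty)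
    {u : ℂ} (h : (supportFace (convexHull ℝ K) u).Nontrivial) : (supportFace K u).Nontrivial := by
  obtain ⟨e, he⟩ := nonempty_supportFace hKc hKne u
  by_contra hs
  rw [not_nontrivial_iff] at hs
  have hsub : convexHull ℝ K ⊆ {x | (conj u * x).re < (conj u * e).re ∨ x = e} := by
    refine convexHull_min (fun x hx => ?_) ?_
    · rcases (he.2 x hx).lt_or_eq with h | h
      · exact Or.inl h
      · exact Or.inr (hs ⟨hx, fun y hy => h ▸ he.2 y hy⟩ he)
    · rw [convex_iff_openSegment_subset]
      rintro x hx y hy _ ⟨a, b, ha, hb, hab, rfl⟩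
      have h₃ : (conj u * (a • x + b • y)).re = a * (conj u * x).re + b * (conj u * y).re := by
        simp; ring
      have h₄ : (conj u * e).re = a * (conj u * e).re + b * (conj u * e).re := by
        rw [← add_mul, hab, one_mul]
      rcases hx with hx | rfl <;> rcases hy with hy | rfl
      · left; rw [h₃, h₄]; gcongr
      · left; linarith [mul_lt_mul_of_pos_left hx ha]
      · left; linarith [mul_lt_mul_of_pos_left hy hb]
      · right; rw [← add_smul, hab, one_smul]
  obtain ⟨y, hy, hye⟩ := h.exists_ne e
  rcases hsub hy.1 with hlt | heq
  · exact absurd (supportFace_eq_of_mem hy (supportFace_subset_supportFace_convexHull K u he)) hlt.ne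
  · exact hye heq

/-- The attractor of a family of contractions lies in every closed nonempty set that the
contractions map into itself. -/
theorem attractor_subset_of_isClosed {X ι : Type*} [PseudoMetricSpace X] {φ : ι → X → X}
    {q : ι → ℝ} (hq : ∀ i, 0 < q i ∧ q i < 1) (hφ : ∀ i x y, dist (φ i x) (φ i y) = q i * dist x y)
    {K C : Set X} (hKc : IsCompact K) (hK : K ⊆ ⋃ i, φ i '' K) (hC : IsClosed C)
    (hCne : C.Nonempty) (hφC : ∀ i, φ i '' C ⊆ C) : K ⊆ C := by
  intro z hz
  obtain ⟨x, hx, hmax⟩ := hKc.exists_isMaxOn ⟨z, hz⟩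
    (Metric.continuous_infDist_pt C).continuousOn
  obtain ⟨i, y, hy, rfl⟩ := mem_iUnion.1 (hK hx)
  have h₁ : Metric.infDist (φ i y) C ≤ q i * Metric.infDist y C := by
    rw [← div_le_iff₀' (hq i).1, Metric.le_infDist hCne]
    intro c hc
    rw [div_le_iff₀' (hq i).1, ← hφ]
    exact Metric.infDist_le_dist_of_mem (hφC i ⟨c, hc, rfl⟩)
  have h₂ : Metric.infDist y C ≤ Metric.infDist (φ i y) C := hmax hy
  have h₃ : Metric.infDist z C ≤ Metric.infDist (φ i y) C := hmax hz
  have h₀ : 0 ≤ Metric.infDist (φ i y) C := Metric.infDist_nonneg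
  have h₄ : Metric.infDist z C = 0 := by
    have := Metric.infDist_nonneg (x := z) (s := C)
    nlinarith [hq i]
  exact (hC.mem_iff_infDist_zero hCne).2 h₄

theorem frontier_diff_extremePoints_eq_iUnion {H : Set ℂ} (hH : Convex ℝ H) (hHc : IsClosed H)
    (hHi : (interior H).Nonempty) :
    frontier H \ H.extremePoints ℝ =
      ⋃ u : {u : ℂ | ‖u‖ = 1 ∧ (supportFace H u).Nontrivial},
        supportFace H (u : ℂ) \ H.extremePoints ℝ := by
  ext x
  rw [hHc.frontier_eq, mem_iUnion]
  constructor
  · rintro ⟨⟨hxH, hxi⟩, hxe⟩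
    obtain ⟨u, hu, hxu⟩ := exists_mem_supportFace hH hHi hxH hxi
    refine ⟨⟨u, hu, ?_⟩, hxu, hxe⟩
    by_contra hs
    rw [not_nontrivial_iff] at hs
    refine hxe (mem_extremePoints.2 ⟨hxH, fun a ha b hb hab => ?_⟩)
    have hext : (conj u * x).re ≤ (conj u * a).re ∧ (conj u * x).re ≤ (conj u * b).re := by
      obtain ⟨s, t, hs, ht, hst, rfl⟩ := hab
      have h₁ := hxu.2 a ha
      have h₂ := hxu.2 b hb
      have h₃ : (conj u * (s • a + t • b)).re = s * (conj u * a).re + t * (conj u * b).re := by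
        simp; ring
      rw [h₃] at h₁ h₂ ⊢
      obtain rfl : t = 1 - s := by linarith
      constructor <;> nlinarith
    exact ⟨hs ⟨ha, fun y hy => (hxu.2 y hy).trans hext.1⟩ hxu,
      hs ⟨hb, fun y hy => (hxu.2 y hy).trans hext.2⟩ hxu⟩
  · rintro ⟨⟨u, hu, _⟩, hxu, hxe⟩
    exact ⟨⟨hxu.1, notMem_interior_of_mem_supportFace hu hxu⟩, hxe⟩

theorem exp_I_mul_rat_mul_pi_pow (s : ℚ) :
    Complex.exp (Complex.I * ((s * Real.pi : ℝ) : ℂ)) ^ (2 * s.den) = 1 := by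
  rw [← Complex.exp_nat_mul, Complex.exp_eq_one_iff]
  refine ⟨s.num, ?_⟩
  have h : (s : ℂ) * s.den = s.num := by exact_mod_cast Rat.mul_den_eq_num s
  push_cast
  linear_combination 2 * Real.pi * Complex.I * h

theorem exists_pow_eq_one_of_commensurable {ι : Type*} [Fintype ι] {α : ι → ℝ}
    (h : ∀ i, ∃ s : ℚ, α i = (s : ℝ) * Real.pi) :
    ∃ M : ℕ, 0 < M ∧ ∀ i, Complex.exp (Complex.I * (α i : ℂ)) ^ M = 1 := by
  choose s hs using h
  refine ⟨∏ i, 2 * (s i).den, Finset.prod_pos fun i _ => by have := (s i).den_pos; positivity,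
    fun i => ?_⟩
  obtain ⟨m, hm⟩ := Finset.dvd_prod_of_mem (fun i => 2 * (s i).den) (Finset.mem_univ i)
  rw [hm, pow_mul, hs, exp_I_mul_rat_mul_pi_pow, one_pow]

/-- For a self-similar set whose rotations `e i` have finite order, every direction of a nontrivial
support face can be rotated by an `M`-th root of unity into the direction of a nontrivial support
face that meets two different pieces. -/
theorem exists_rotation_meeting_two_pieces {ι : Type*} {K : Set ℂ}
    (hKc : IsCompact K) {q : ι → ℝ} {e b : ι → ℂ} (hq : ∀ i, 0 < q i ∧ q i < 1)
    {M : ℕ} (hM : 0 < M) (he : ∀ i, e i ^ M = 1)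
    (hK : K ⊆ ⋃ i, (fun z => q i * e i * z + b i) '' K)
    (hmaps : ∀ i, (fun z => q i * e i * z + b i) '' K ⊆ K)
    {u : ℂ} (hu : (supportFace K u).Nontrivial) :
    ∃ g : ℂ, g ^ M = 1 ∧ (supportFace K (g * u)).Nontrivial ∧ ∃ i j, i ≠ j ∧
      (supportFace K (g * u) ∩ (fun z => q i * e i * z + b i) '' K).Nonempty ∧
      (supportFace K (g * u) ∩ (fun z => q j * e j * z + b j) '' K).Nonempty := by
  have hbdd : ∀ v, Bornology.IsBounded (supportFace K v) := fun v =>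
    hKc.isBounded.subset fun x hx => hx.1
  have hdiam : ∀ v, 0 < Metric.diam (supportFace K v) ↔ (supportFace K v).Nontrivial := by
    intro v
    constructor
    · intro h
      by_contra hs
      rw [not_nontrivial_iff] at hs
      rw [Metric.diam_subsingleton hs] at h
      exact lt_irrefl _ h
    · rintro ⟨x, hx, y, hy, hxy⟩
      exact (dist_pos.2 hxy).trans_le (Metric.dist_le_diam_of_mem (hbdd v) hx hy)
  obtain ⟨g, hg, hmax⟩ := (Polynomial.nthRootsFinset M (1 : ℂ)).exists_max_image
    (fun g => Metric.diam (supportFace K (g * u)))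
    ⟨1, (Polynomial.mem_nthRootsFinset hM 1).2 (one_pow M)⟩
  rw [Polynomial.mem_nthRootsFinset hM] at hg
  have hpos : 0 < Metric.diam (supportFace K (g * u)) := by
    have h₁ := hmax 1 ((Polynomial.mem_nthRootsFinset hM 1).2 (one_pow M))
    rw [one_mul] at h₁
    exact ((hdiam u).2 hu).trans_le h₁
  have hnt := (hdiam _).1 hpos
  refine ⟨g, hg, hnt, ?_⟩
  by_contra! hcon
  obtain ⟨x₀, hx₀⟩ := hnt.nonempty
  obtain ⟨i, hi⟩ := mem_iUnion.1 (hK hx₀.1)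
  have hnorm : ‖e i‖ = 1 := Complex.norm_eq_one_of_pow_eq_one (he i) hM.ne'
  have hunit : conj (e i) * e i = 1 := by
    rw [mul_comm, Complex.mul_conj, Complex.normSq_eq_norm_sq, hnorm]; simp
  have hall : ∀ x ∈ supportFace K (g * u), ∃ y ∈ supportFace K (conj (e i) * g * u),
      q i * e i * y + b i = x := by
    intro x hx
    obtain ⟨j, hj⟩ := mem_iUnion.1 (hK hx.1)
    obtain rfl : i = j := by
      by_contra hij
      exact (eq_empty_iff_forall_notMem.1 (hcon i j hij ⟨x₀, hx₀, hi⟩)) x ⟨hx, hj⟩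
    obtain ⟨y, hy, rfl⟩ := hj
    refine ⟨y, ⟨hy, fun z hz => ?_⟩, rfl⟩
    have h := hx.2 _ (hmaps i ⟨z, hz, rfl⟩)
    have hexp : ∀ z, (conj (g * u) * (q i * e i * z + b i)).re
        = q i * (conj (conj (e i) * g * u) * z).re + (conj (g * u) * b i).re := by
      intro z
      rw [← Complex.re_ofReal_mul, ← Complex.add_re]
      congr 1
      simp only [map_mul, Complex.conj_conj]
      ring
    simp only [hexp] at h
    exact le_of_mul_le_mul_left (by linarith) (hq i).1
  have hle : Metric.diam (supportFace K (g * u)) ≤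
      q i * Metric.diam (supportFace K (conj (e i) * g * u)) := by
    refine Metric.diam_le_of_forall_dist_le
      (mul_nonneg (hq i).1.le Metric.diam_nonneg) fun x hx y hy => ?_
    obtain ⟨x', hx', rfl⟩ := hall x hx
    obtain ⟨y', hy', rfl⟩ := hall y hy
    have : dist (q i * e i * x' + b i) (q i * e i * y' + b i) = q i * dist x' y' := by
      rw [dist_add_right, dist_eq_norm, ← mul_sub, norm_mul, norm_mul, hnorm, Complex.norm_real,
        Real.norm_of_nonneg (hq i).1.le, mul_one, dist_eq_norm]
    rw [this]
    exact mul_le_mul_of_nonneg_left (Metric.dist_le_diam_of_mem (hbdd _) hx' hy') (hq i).1.le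
  have hge := hmax (conj (e i) * g) ((Polynomial.mem_nthRootsFinset hM 1).2 (by
    rw [mul_pow, hg, ← map_pow, he, map_one, one_mul]))
  nlinarith [hq i]

/-- Theorem 7: if the system satisfies the open convex set condition and every rotation
angle `αᵢ` is commensurable with `π`, then `K̃ = convexHull ℝ K` has only finitely many
sides: the set `frontier K̃ \ extremePoints ℝ K̃` has finitely many connected components. -/
theorem finitely_many_sides_of_commensurable_angles
    (n : ℕ) (hn : 2 ≤ n)
    (qs αs : Fin n → ℝ) (zs : Fin n → ℂ)
    (hqs : ∀ i, 0 < qs i ∧ qs i < 1)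
    (φ : Fin n → ℂ → ℂ)
    (hφ : ∀ i z, φ i z = (qs i : ℂ) * Complex.exp (Complex.I * (αs i : ℂ)) * (z - zs i) + zs i)
    (K : Set ℂ) (hKne : K.Nonempty) (hKc : IsCompact K)
    (hKinv : K = ⋃ i, φ i '' K)
    (hOCSC : ∃ O : Set ℂ, O.Nonempty ∧ IsOpen O ∧ Convex ℝ O ∧
      (⋃ i, φ i '' O) ⊆ O ∧ ∀ i j, i ≠ j → φ i '' O ∩ φ j '' O = ∅)
    (hcomm : ∀ i, ∃ s : ℚ, αs i = (s : ℝ) * Real.pi) :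
    Finite (ConnectedComponents
      ↥(frontier (convexHull ℝ K) \ extremePoints ℝ (convexHull ℝ K))) := by
  have hHc : IsClosed (convexHull ℝ K) := (isCompact_convexHull_of_isCompact hKc).isClosed
  have hH : Convex ℝ (convexHull ℝ K) := convex_convexHull ℝ K
  rcases (interior (convexHull ℝ K)).eq_empty_or_nonempty with hHi | hHi
  · rw [hHc.frontier_eq, hHi, sdiff_empty]
    exact finite_connectedComponents_of_iUnion (ι := Unit)
      (fun _ => convexHull ℝ K \ extremePoints ℝ (convexHull ℝ K))
      (fun _ => (hH.diff_extremePoints subset_rfl).isPreconnected) (iUnion_const _).symm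
  obtain ⟨O, hOne, hOo, hOc, hOmaps, hOdisj⟩ := hOCSC
  obtain ⟨M, hM, he⟩ := exists_pow_eq_one_of_commensurable hcomm
  set e : Fin n → ℂ := fun i => Complex.exp (Complex.I * (αs i : ℂ)) with he_def
  set b : Fin n → ℂ := fun i => zs i - qs i * e i * zs i with hb_def
  have hφe : ∀ i, φ i = fun z => qs i * e i * z + b i := by
    intro i
    funext z
    rw [hφ]
    simp only [hb_def, he_def]
    ring
  have hnorm : ∀ i, ‖e i‖ = 1 := fun i => Complex.norm_eq_one_of_pow_eq_one (he i) hM.ne'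
  have hdist : ∀ i x y, dist (φ i x) (φ i y) = qs i * dist x y := by
    intro i x y
    rw [hφe, dist_add_right, dist_eq_norm, ← mul_sub, norm_mul, norm_mul, hnorm,
      Complex.norm_real, Real.norm_of_nonneg (hqs i).1.le, mul_one, dist_eq_norm]
  have hcont : ∀ i, Continuous (φ i) := fun i => by rw [hφe]; fun_prop
  have hKmaps : ∀ i, φ i '' K ⊆ K := fun i => by
    conv_rhs => rw [hKinv]
    exact subset_iUnion (fun i => φ i '' K) i
  have hKO : K ⊆ closure O := by
    refine attractor_subset_of_isClosed hqs hdist hKc hKinv.subset isClosed_closure hOne.closure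
      fun i => ?_
    exact (image_closure_subset_closure_image (hcont i)).trans
      (closure_mono ((subset_iUnion (fun i => φ i '' O) i).trans hOmaps))
  have hHO : interior (convexHull ℝ K) ⊆ O := by
    have h := interior_mono (convexHull_min hKO hOc.closure)
    rwa [hOc.interior_closure_eq_interior_of_nonempty_interior (by rwa [hOo.interior_eq]),
      hOo.interior_eq] at h
  have hmul : ∀ i, (qs i : ℂ) * e i ≠ 0 := fun i =>
    mul_ne_zero (by exact_mod_cast (hqs i).1.ne') (Complex.exp_ne_zero _)
  have hφhomeo : ∀ i, ∃ h : ℂ ≃ₜ ℂ, ⇑h = φ i := fun i =>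
    ⟨(Homeomorph.mulLeft₀ _ (hmul i)).trans (Homeomorph.addRight (b i)), by
      rw [hφe]; rfl⟩
  have hint : ∀ i, interior (φ i '' convexHull ℝ K) = φ i '' interior (convexHull ℝ K) := by
    intro i
    obtain ⟨h, hh⟩ := hφhomeo i
    rw [← hh, h.image_interior]
  have himage : ∀ i, φ i '' convexHull ℝ K = convexHull ℝ (φ i '' K) := by
    intro i
    let L : ℂ →ᵃ[ℝ] ℂ := (LinearMap.mulLeft ℝ ((qs i : ℂ) * e i)).toAffineMap +
      AffineMap.const ℝ ℂ (b i)
    have hL : ⇑L = φ i := by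
      rw [hφe]; rfl
    rw [← hL, L.image_convexHull]
  have hpieces : ∀ i, φ i '' convexHull ℝ K ⊆ convexHull ℝ K := fun i => by
    rw [himage]
    exact convexHull_mono (hKmaps i)
  have hTfin : (⋃ i, ⋃ j, ⋃ _ : i ≠ j, {u | ‖u‖ = 1 ∧
      (supportFace (convexHull ℝ K) u).Nontrivial ∧
      (supportFace (convexHull ℝ K) u ∩ φ i '' convexHull ℝ K).Nonempty ∧
      (supportFace (convexHull ℝ K) u ∩ φ j '' convexHull ℝ K).Nonempty}).Finite := by
    refine finite_iUnion fun i => finite_iUnion fun j => finite_iUnion fun hij => ?_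
    refine finite_supportFace_meeting_both hH (by rw [himage]; exact convex_convexHull ℝ _)
      (by rw [himage]; exact convex_convexHull ℝ _) (hpieces i) (hpieces j)
      (by rw [hint]; exact hHi.image _) (by rw [hint]; exact hHi.image _) ?_
    rw [hint, hint]
    exact (disjoint_iff_inter_eq_empty.2 (hOdisj i j hij)).mono (image_mono hHO) (image_mono hHO)
  have hUfin : {u : ℂ | ‖u‖ = 1 ∧ (supportFace (convexHull ℝ K) u).Nontrivial}.Finite := by
    refine (Finite.image2 (fun g t => g⁻¹ * t)
      (Polynomial.nthRootsFinset M (1 : ℂ)).finite_toSet hTfin).subset ?_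
    rintro u ⟨hu, hnt⟩
    simp only [hφe] at hKinv hKmaps
    obtain ⟨g, hg, hgnt, i, j, hij, hi, hj⟩ := exists_rotation_meeting_two_pieces hKc hqs hM
      he hKinv.subset hKmaps (nontrivial_supportFace_of_convexHull hKc hKne hnt)
    have hgn : ‖g‖ = 1 := Complex.norm_eq_one_of_pow_eq_one hg hM.ne'
    have hg0 : g ≠ 0 := norm_ne_zero_iff.1 (by rw [hgn]; exact one_ne_zero)
    have hsub := supportFace_subset_supportFace_convexHull K (g * u)
    refine ⟨g, (Polynomial.mem_nthRootsFinset hM 1).2 hg, g * u, ?_,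
      inv_mul_cancel_left₀ hg0 u⟩
    simp only [mem_iUnion]
    rw [← hφe] at hi hj
    have himg : ∀ i, φ i '' K ⊆ φ i '' convexHull ℝ K := fun i =>
      image_mono (subset_convexHull ℝ K)
    exact ⟨i, j, hij, by rw [norm_mul, hgn, hu, one_mul], hgnt.mono hsub,
      hi.mono (inter_subset_inter hsub (himg i)), hj.mono (inter_subset_inter hsub (himg j))⟩
  have : Finite {u : ℂ | ‖u‖ = 1 ∧ (supportFace (convexHull ℝ K) u).Nontrivial} := hUfin
  exact finite_connectedComponents_of_iUnion
    (ι := {u : ℂ | ‖u‖ = 1 ∧ (supportFace (convexHull ℝ K) u).Nontrivial}) _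
    (fun u => ((convex_supportFace hH (u : ℂ)).diff_extremePoints
      fun x hx => hx.1).isPreconnected)
    (frontier_diff_extremePoints_eq_iUnion hH hHc hHi)
end

section
/- Suppose the system (φ₁,…,φₙ) satisfies the open convex set condition. Let z₀ be a corner point of K̃ = convexHull ℝ K, i.e. a point of K̃ for which there exist two ℝ-linearly independent vectors u, v ∈ ℂ with Re(conj(u)·(x − z₀)) ≤ 0 and Re(conj(v)·(x − z₀)) ≤ 0 for all x ∈ K̃. Then z₀ is a periodic vertex: there exist a (possibly empty) finite word w and a nonempty finite word u in {1,…,n} such that z₀ = φ_w(z*) where z* is the unique fixed point of φ_u. -/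
open Set

/-- The set `S` lies in the cone with apex `z` and axis direction `-w` on which the linear
functional `x ↦ Re (conj w * (x - z))` is at most `-ε * ‖x - z‖`. -/
def SupportedAt (S : Set ℂ) (ε : ℝ) (z w : ℂ) : Prop :=
  ∀ x ∈ S, ((starRingEnd ℂ) w * (x - z)).re ≤ -ε * ‖x - z‖

lemma SupportedAt.eq_of_norm_sub_lt {S : Set ℂ} {ε : ℝ} {z z' w w' : ℂ}
    (h : SupportedAt S ε z w) (h' : SupportedAt S ε z' w') (hz : z ∈ S) (hz' : z' ∈ S)
    (hw : ‖w - w'‖ < 2 * ε) : z = z' := by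
  have h1 := h z' hz'
  have h2 := h' z hz
  rw [norm_sub_rev] at h2
  have h3 : -(‖w - w'‖ * ‖z' - z‖) ≤ ((starRingEnd ℂ) (w - w') * (z' - z)).re := by
    rw [← RCLike.norm_conj (w - w'), ← norm_mul]
    exact neg_le_of_abs_le (Complex.abs_re_le_norm _)
  have h4 : ((starRingEnd ℂ) (w - w') * (z' - z)).re
      = ((starRingEnd ℂ) w * (z' - z)).re + ((starRingEnd ℂ) w' * (z - z')).re := by
    rw [map_sub, ← Complex.add_re]
    congr 1
    ring
  have h5 : ‖z' - z‖ = 0 := by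
    have := norm_nonneg (z' - z)
    nlinarith
  exact (sub_eq_zero.mp (norm_eq_zero.mp h5)).symm

lemma SupportedAt.mem_of_mem_convexHull {S : Set ℂ} {ε : ℝ} {z w : ℂ} (hε : 0 < ε)
    (h : SupportedAt S ε z w) (hz : z ∈ convexHull ℝ S) : z ∈ S := by
  by_contra hzS
  have hlin : IsLinearMap ℝ fun x : ℂ => ((starRingEnd ℂ) w * x).re :=
    ⟨fun x y => by simp [mul_add], fun c x => by simp; ring⟩
  have hsub : S ⊆ {x | ((starRingEnd ℂ) w * x).re < ((starRingEnd ℂ) w * z).re} := by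
    intro x hx
    have hpos : 0 < ‖x - z‖ :=
      norm_pos_iff.mpr (sub_ne_zero.mpr fun hxz => hzS (hxz ▸ hx))
    have hx' := h x hx
    rw [mul_sub, Complex.sub_re] at hx'
    have := mul_pos hε hpos
    simp only [mem_ofPred_eq]
    linarith
  have hlt := convexHull_min hsub (convex_halfSpace_lt hlin _) hz
  simp only [mem_ofPred_eq, lt_irrefl] at hlt

lemma exists_supportedAt_of_linearIndependent {S : Set ℂ} {z u v : ℂ}
    (huv : LinearIndependent ℝ ![u, v])
    (h : ∀ x ∈ S, ((starRingEnd ℂ) u * (x - z)).re ≤ 0 ∧ ((starRingEnd ℂ) v * (x - z)).re ≤ 0) :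
    ∃ ε > 0, SupportedAt S ε z (u + v) := by
  have hu : u ≠ 0 := huv.ne_zero 0
  set D : ℝ := u.re * v.im - u.im * v.re with hD
  have hD0 : D ≠ 0 := by
    intro h0
    rw [LinearIndependent.pair_iff] at huv
    have hre := huv v.re (-u.re) (by
      apply Complex.ext
      · simp; ring
      · simp; linarith)
    have him := huv v.im (-u.im) (by
      apply Complex.ext
      · simp; linarith
      · simp; ring)
    exact hu (Complex.ext (by simpa using hre.2) (by simpa using him.2))
  have hC : 0 < ‖u‖ + ‖v‖ := by positivity
  refine ⟨|D| / (‖u‖ + ‖v‖), by positivity, fun x hx => ?_⟩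
  obtain ⟨ha, hb⟩ := h x hx
  set y := x - z
  set a := ((starRingEnd ℂ) u * y).re with hadef
  set b := ((starRingEnd ℂ) v * y).re with hbdef
  have hy : (D : ℂ) * y = Complex.I * (b * u - a * v) := by
    apply Complex.ext
    · simp [hadef, hbdef, hD]; ring
    · simp [hadef, hbdef, hD]; ring
  have hnorm : |D| * ‖y‖ ≤ (‖u‖ + ‖v‖) * -(a + b) := by
    calc |D| * ‖y‖ = ‖(D : ℂ) * y‖ := by simp
      _ = ‖(b : ℂ) * u - a * v‖ := by rw [hy]; simp
      _ ≤ ‖(b : ℂ) * u‖ + ‖(a : ℂ) * v‖ := norm_sub_le _ _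
      _ = -b * ‖u‖ + -a * ‖v‖ := by simp [abs_of_nonpos ha, abs_of_nonpos hb]
      _ ≤ (‖u‖ + ‖v‖) * -(a + b) := by nlinarith [norm_nonneg u, norm_nonneg v]
  have hsum : ((starRingEnd ℂ) (u + v) * y).re = a + b := by
    rw [map_add, add_mul, Complex.add_re]
  rw [hsum, neg_mul, div_mul_eq_mul_div, le_neg, div_le_iff₀ hC]
  linarith

lemma SupportedAt.of_similitude {S : Set ℂ} {ε q α : ℝ} {f : ℂ → ℂ} {c y w : ℂ} (hq : 0 < q)
    (hf : ∀ z, f z = (q : ℂ) * Complex.exp (Complex.I * (α : ℂ)) * (z - c) + c)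
    (hS : MapsTo f S S) (h : SupportedAt S ε (f y) w) :
    SupportedAt S ε y (w * Complex.exp (-(Complex.I * (α : ℂ)))) := by
  intro x hx
  have hfx := h (f x) (hS hx)
  have hsub : f x - f y = q * (Complex.exp (Complex.I * (α : ℂ)) * (x - y)) := by
    rw [hf, hf]
    ring
  have hexp : ‖Complex.exp (Complex.I * (α : ℂ))‖ = 1 := by
    rw [mul_comm, Complex.norm_exp_ofReal_mul_I]
  have hconj : (starRingEnd ℂ) (Complex.exp (-(Complex.I * (α : ℂ))))
      = Complex.exp (Complex.I * (α : ℂ)) := by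
    rw [← Complex.exp_conj]
    simp
  rw [hsub, norm_mul, norm_mul, hexp, mul_left_comm, Complex.re_ofReal_mul, Complex.norm_real,
    Real.norm_of_nonneg hq.le] at hfx
  rw [map_mul, hconj, mul_assoc]
  refine le_of_mul_le_mul_left ?_ hq
  linarith

lemma exists_lt_norm_sub_lt_of_bounded {w : ℕ → ℂ} {R δ : ℝ} (hw : ∀ k, ‖w k‖ ≤ R)
    (hδ : 0 < δ) : ∃ j k, j < k ∧ ‖w j - w k‖ < δ := by
  obtain ⟨_, _, ψ, hψ, hlim⟩ := (isCompact_closedBall (0 : ℂ) R).tendsto_subseq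
    (x := w) fun k => by simpa using hw k
  obtain ⟨N, hN⟩ := Metric.cauchySeq_iff.mp hlim.cauchySeq δ hδ
  refine ⟨ψ N, ψ (N + 1), hψ N.lt_succ_self, ?_⟩
  simpa [dist_eq_norm] using hN N le_rfl (N + 1) N.le_succ

lemma exists_word_of_orbit {ι X : Type*} {φ : ι → X → X} {Φ : List ι → X → X}
    (hnil : Φ [] = id) (hcons : ∀ i w, Φ (i :: w) = φ i ∘ Φ w) {z : ℕ → X}
    (hz : ∀ k, ∃ i, z k = φ i (z (k + 1))) (m j : ℕ) :
    ∃ w : List ι, w.length = m ∧ z j = Φ w (z (j + m)) := by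
  induction m generalizing j with
  | zero => exact ⟨[], rfl, by simp [hnil]⟩
  | succ m ih =>
    obtain ⟨w, hlen, hw⟩ := ih (j + 1)
    obtain ⟨i, hi⟩ := hz j
    refine ⟨i :: w, by simp [hlen], ?_⟩
    rw [hcons, Function.comp_apply, hi, hw, add_right_comm, add_assoc]

/-- Proposition 8: under the open convex set condition, every corner point `z₀` of
`K̃ = convexHull ℝ K` (a point admitting two linearly independent supporting directions)
is a periodic vertex: `z₀ = φ_w(z*)` for some word `w` and some fixed point `z*` of a
nonempty-word composition `φ_u`. -/
theorem corner_point_is_periodic_vertex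
    (n : ℕ) (hn : 2 ≤ n)
    (qs αs : Fin n → ℝ) (zs : Fin n → ℂ)
    (hqs : ∀ i, 0 < qs i ∧ qs i < 1)
    (φ : Fin n → ℂ → ℂ)
    (hφ : ∀ i z, φ i z = (qs i : ℂ) * Complex.exp (Complex.I * (αs i : ℂ)) * (z - zs i) + zs i)
    (K : Set ℂ) (hKne : K.Nonempty) (hKc : IsCompact K)
    (hKinv : K = ⋃ i, φ i '' K)
    (hOCSC : ∃ O : Set ℂ, O.Nonempty ∧ IsOpen O ∧ Convex ℝ O ∧
      (⋃ i, φ i '' O) ⊆ O ∧ ∀ i j, i ≠ j → φ i '' O ∩ φ j '' O = ∅)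
    (Φ : List (Fin n) → ℂ → ℂ)
    (hΦnil : Φ [] = id)
    (hΦcons : ∀ i w, Φ (i :: w) = φ i ∘ Φ w)
    (z₀ : ℂ) (hz₀ : z₀ ∈ convexHull ℝ K)
    (hcorner : ∃ u v : ℂ, LinearIndependent ℝ ![u, v] ∧
      ∀ x ∈ convexHull ℝ K, ((starRingEnd ℂ) u * (x - z₀)).re ≤ 0 ∧
        ((starRingEnd ℂ) v * (x - z₀)).re ≤ 0) :
    ∃ (w u : List (Fin n)), u ≠ [] ∧ ∃ zstar : ℂ,
      Function.IsFixedPt (Φ u) zstar ∧ z₀ = Φ w zstar := by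
  obtain ⟨u, v, huv, hsupp⟩ := hcorner
  obtain ⟨ε, hε, h₀⟩ := exists_supportedAt_of_linearIndependent huv
    fun x hx => hsupp x (subset_convexHull ℝ K hx)
  have hmaps : ∀ i, MapsTo (φ i) K K := fun i x hx => by
    rw [hKinv]
    exact mem_iUnion_of_mem i (mem_image_of_mem _ hx)
  let State := {p : ℂ × ℂ // p.1 ∈ K ∧ SupportedAt K ε p.1 p.2 ∧ ‖p.2‖ = ‖u + v‖}
  have hstep : ∀ p : State, ∃ p' : State, ∃ i, p.1.1 = φ i p'.1.1 := by
    rintro ⟨⟨z, w⟩, hzK, hzw, hw⟩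
    have hz' := hzK
    simp only at hz' hzw hw
    rw [hKinv, mem_iUnion] at hz'
    obtain ⟨i, y, hy, rfl⟩ := hz'
    refine ⟨⟨(y, w * Complex.exp (-(Complex.I * (αs i : ℂ)))), hy,
      hzw.of_similitude (hqs i).1 (hφ i) (hmaps i), ?_⟩, i, rfl⟩
    have hexp : ‖Complex.exp (-(Complex.I * (αs i : ℂ)))‖ = 1 := by
      simp [Complex.norm_exp]
    rw [norm_mul, hexp, mul_one, hw]
  choose next hnext using hstep
  let s : ℕ → State :=
    fun k => next^[k] ⟨(z₀, u + v), h₀.mem_of_mem_convexHull hε hz₀, h₀, rfl⟩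
  have hs : ∀ k, ∃ i, (s k).1.1 = φ i (s (k + 1)).1.1 := fun k => by
    simp only [s, Function.iterate_succ_apply']
    exact hnext _
  obtain ⟨j, k, hjk, hclose⟩ := exists_lt_norm_sub_lt_of_bounded
    (w := fun k => (s k).1.2) (fun k => (s k).2.2.2.le) (mul_pos two_pos hε)
  have heq : (s j).1.1 = (s k).1.1 :=
    (s j).2.2.1.eq_of_norm_sub_lt (s k).2.2.1 (s j).2.1 (s k).2.1 hclose
  obtain ⟨w₁, -, hw₁⟩ := exists_word_of_orbit hΦnil hΦcons (z := fun k => (s k).1.1) hs j 0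
  obtain ⟨w₂, hlen, hw₂⟩ :=
    exists_word_of_orbit hΦnil hΦcons (z := fun k => (s k).1.1) hs (k - j) j
  refine ⟨w₁, w₂, ?_, (s j).1.1, ?_, ?_⟩
  · rintro rfl
    simp only [List.length_nil] at hlen
    omega
  · rw [Nat.add_sub_cancel' hjk.le] at hw₂
    simp only [← heq] at hw₂
    exact hw₂.symm
  · simpa [s] using hw₁
end

section
/- Suppose the system (φ₁,…,φₙ) satisfies the open convex set condition, and suppose the rotation angles satisfy: for all nonnegative integers k₁,…,kₙ not all zero and all integers m, k₁α₁ + … + kₙαₙ ≠ m·π. Then the set of extreme points of K̃ = convexHull ℝ K is infinite. -/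
open Set

/-- A non-real complex number has two consecutive powers whose nonnegative combinations
contain `-1`. -/
lemma Complex.exists_nonneg_combination_pow_eq_neg_one_of_im_pos {c : ℂ} (hc : 0 < c.im) :
    ∃ (k : ℕ) (a b : ℝ), 0 ≤ a ∧ 0 ≤ b ∧ (a : ℂ) * c ^ k + b * c ^ (k + 1) = -1 := by
  have hex : ∃ k : ℕ, 0 < (c ^ k).im ∧ (c ^ (k + 1)).im ≤ 0 := by
    have hθ0 : 0 < c.arg := by
      refine lt_of_le_of_ne (Complex.arg_nonneg_iff.2 hc.le) fun h => ?_
      exact hc.ne' (Complex.arg_eq_zero_iff.1 h.symm).2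
    have hθπ : c.arg < Real.pi :=
      lt_of_le_of_ne (Complex.arg_le_pi c) fun h => hc.ne' (Complex.arg_eq_pi_iff.1 h).2
    have him : ∀ k : ℕ, (c ^ k).im = ‖c‖ ^ k * Real.sin (k * c.arg) := by
      intro k
      have h : c ^ k = ((‖c‖ ^ k : ℝ) : ℂ) * Complex.exp (((k * c.arg : ℝ) : ℂ) * Complex.I) := by
        conv_lhs => rw [← Complex.norm_mul_exp_arg_mul_I c, mul_pow, ← Complex.exp_nat_mul]
        push_cast
        ring_nf
      rw [h, Complex.im_ofReal_mul, Complex.exp_ofReal_mul_I_im]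
    have hr : 0 < ‖c‖ := norm_pos_iff.2 fun h => by simp [h] at hc
    obtain ⟨m, hm⟩ : ∃ m, m = ⌈Real.pi / c.arg⌉₊ := ⟨_, rfl⟩
    have h1 : Real.pi ≤ m * c.arg := by
      rw [← div_le_iff₀ hθ0, hm]
      exact Nat.le_ceil _
    have h2 : m * c.arg < Real.pi + c.arg := by
      have h := Nat.ceil_lt_add_one (div_pos Real.pi_pos hθ0).le
      rw [← hm] at h
      calc m * c.arg < (Real.pi / c.arg + 1) * c.arg := by gcongr
        _ = Real.pi + c.arg := by field_simp
    have hm0 : m ≠ 0 := by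
      rintro rfl
      simp only [Nat.cast_zero, zero_mul] at h1
      linarith [Real.pi_pos]
    obtain ⟨k, rfl⟩ := Nat.exists_eq_succ_of_ne_zero hm0
    push_cast at h1 h2
    refine ⟨k, ?_, ?_⟩
    · rw [him]
      exact mul_pos (pow_pos hr _) (Real.sin_pos_of_pos_of_lt_pi (by linarith) (by linarith))
    · rw [him]
      refine mul_nonpos_of_nonneg_of_nonpos (pow_pos hr _).le ?_
      rw [← neg_nonneg, ← Real.sin_sub_pi]
      exact Real.sin_nonneg_of_nonneg_of_le_pi (by push_cast; linarith) (by push_cast; linarith)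
  obtain ⟨k, hp, hq⟩ := hex
  have hneg : -(c ^ (k + 1)).im * (c ^ k).re + (c ^ k).im * (c ^ (k + 1)).re < 0 := by
    have h : -(c ^ (k + 1)).im * (c ^ k).re + (c ^ k).im * (c ^ (k + 1)).re
        = -(((c ^ k).re ^ 2 + (c ^ k).im ^ 2) * c.im) := by
      rw [pow_succ, Complex.mul_re, Complex.mul_im]
      ring
    rw [h]
    have : 0 < (c ^ k).re ^ 2 + (c ^ k).im ^ 2 := by positivity
    exact neg_neg_of_pos (mul_pos this hc)
  obtain ⟨t, ht⟩ : ∃ t, t = -(-(c ^ (k + 1)).im * (c ^ k).re + (c ^ k).im * (c ^ (k + 1)).re) :=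
    ⟨_, rfl⟩
  have ht0 : 0 < t := by linarith
  refine ⟨k, -(c ^ (k + 1)).im / t, (c ^ k).im / t, div_nonneg (by linarith) ht0.le,
    div_nonneg hp.le ht0.le, ?_⟩
  apply Complex.ext
  · rw [Complex.add_re, Complex.re_ofReal_mul, Complex.re_ofReal_mul, Complex.neg_re,
      Complex.one_re]
    field_simp
    linarith
  · rw [Complex.add_im, Complex.im_ofReal_mul, Complex.im_ofReal_mul, Complex.neg_im,
      Complex.one_im]
    field_simp
    ring

/-- A non-real complex number has two consecutive powers whose nonnegative combinations
contain `-1`. -/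
lemma Complex.exists_nonneg_combination_pow_eq_neg_one {c : ℂ} (hc : c.im ≠ 0) :
    ∃ (k : ℕ) (a b : ℝ), 0 ≤ a ∧ 0 ≤ b ∧ (a : ℂ) * c ^ k + b * c ^ (k + 1) = -1 := by
  rcases hc.lt_or_gt with h | h
  · obtain ⟨k, a, b, ha, hb, hab⟩ :=
      Complex.exists_nonneg_combination_pow_eq_neg_one_of_im_pos (c := starRingEnd ℂ c)
        (by simpa using h)
    refine ⟨k, a, b, ha, hb, ?_⟩
    simpa using congrArg (starRingEnd ℂ) hab
  · exact Complex.exists_nonneg_combination_pow_eq_neg_one_of_im_pos h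

/-- The center of a similitude with non-real multiplier that preserves a convex set `S` lies on
an open segment in `S` issuing from any given point of `S`. -/
lemma Convex.exists_mem_openSegment_of_similitude {S : Set ℂ} (hS : Convex ℝ S) {c v : ℂ}
    (hc : c.im ≠ 0) (hmaps : ∀ z ∈ S, c * (z - v) + v ∈ S) {x : ℂ} (hx : x ∈ S) :
    ∃ y ∈ S, v ∈ openSegment ℝ x y := by
  have hpow : ∀ k : ℕ, c ^ k * (x - v) + v ∈ S := by
    intro k
    induction k with
    | zero => simpa using hx
    | succ k ih =>
      convert hmaps _ ih using 1
      ring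
  obtain ⟨k, a, b, ha, hb, hab⟩ := Complex.exists_nonneg_combination_pow_eq_neg_one hc
  have hs : 0 < a + b := by
    refine lt_of_le_of_ne (add_nonneg ha hb) fun h => ?_
    have ha0 : a = 0 := by linarith
    have hb0 : b = 0 := by linarith
    simp [ha0, hb0] at hab
  refine ⟨_, hS (hpow k) (hpow (k + 1)) (div_nonneg ha hs.le) (div_nonneg hb hs.le)
    (by field_simp), 1 / (1 + (a + b)), (a + b) / (1 + (a + b)), by positivity, by positivity,
    by field_simp, ?_⟩
  have h1 : (a : ℂ) + b ≠ 0 := by exact_mod_cast hs.ne'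
  have h2 : 1 + ((a : ℂ) + b) ≠ 0 := by
    have : (1 : ℝ) + (a + b) ≠ 0 := by positivity
    exact_mod_cast this
  simp only [Complex.real_smul]
  push_cast
  field_simp
  linear_combination (x - v) * hab

/-- The convex hull of a nonempty compact set in a strictly convex space has an extreme point:
any point of the set of maximal norm is one. -/
lemma IsCompact.extremePoints_convexHull_nonempty {E : Type*} [NormedAddCommGroup E]
    [NormedSpace ℝ E] [StrictConvexSpace ℝ E] {K : Set E} (hK : IsCompact K)
    (hne : K.Nonempty) : (extremePoints ℝ (convexHull ℝ K)).Nonempty := by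
  obtain ⟨v, hv, hmax⟩ := hK.exists_isMaxOn hne continuous_norm.continuousOn
  have hball : convexHull ℝ K ⊆ Metric.closedBall 0 ‖v‖ :=
    convexHull_min (fun z hz => mem_closedBall_zero_iff.2 (hmax hz)) (convex_closedBall 0 ‖v‖)
  refine ⟨v, mem_extremePoints.2 ⟨subset_convexHull ℝ K hv, ?_⟩⟩
  rintro x hx y hy ⟨a, b, ha, hb, hab, rfl⟩
  obtain rfl : x = y := by
    by_contra hxy
    exact lt_irrefl _ (norm_combo_lt_of_ne (mem_closedBall_zero_iff.1 (hball hx))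
      (mem_closedBall_zero_iff.1 (hball hy)) hxy ha hb hab)
  rw [Convex.combo_self hab]
  exact ⟨rfl, rfl⟩

/-- Proposition 9: if the system satisfies the open convex set condition and no nonnegative
integer combination of the rotation angles (not all coefficients zero) is an integer
multiple of `π`, then the set of extreme points of `K̃ = convexHull ℝ K` is infinite. -/
theorem extreme_points_infinite_of_incommensurable_angles
    (n : ℕ) (hn : 2 ≤ n)
    (qs αs : Fin n → ℝ) (zs : Fin n → ℂ)
    (hqs : ∀ i, 0 < qs i ∧ qs i < 1)
    (φ : Fin n → ℂ → ℂ)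
    (hφ : ∀ i z, φ i z = (qs i : ℂ) * Complex.exp (Complex.I * (αs i : ℂ)) * (z - zs i) + zs i)
    (K : Set ℂ) (hKne : K.Nonempty) (hKc : IsCompact K)
    (hKinv : K = ⋃ i, φ i '' K)
    (hOCSC : ∃ O : Set ℂ, O.Nonempty ∧ IsOpen O ∧ Convex ℝ O ∧
      (⋃ i, φ i '' O) ⊆ O ∧ ∀ i j, i ≠ j → φ i '' O ∩ φ j '' O = ∅)
    (hangles : ∀ k : Fin n → ℕ, (∃ i, k i ≠ 0) →
      ∀ m : ℤ, ∑ i, (k i : ℝ) * αs i ≠ (m : ℝ) * Real.pi) :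
    (extremePoints ℝ (convexHull ℝ K)).Infinite := by
  obtain ⟨O, ⟨o, ho⟩, -, hOconv, hOsub, hOdisj⟩ := hOCSC
  set c : Fin n → ℂ := fun i => (qs i : ℂ) * Complex.exp (Complex.I * (αs i : ℂ)) with hcdef
  have hφsub : ∀ i z w, φ i z = c i * (z - w) + φ i w := by
    intro i z w
    rw [hφ, hφ]
    ring
  have him : ∀ (r : ℝ) (k : Fin n → ℕ), r ≠ 0 → (∃ i, k i ≠ 0) →
      ((r : ℂ) * Complex.exp (Complex.I * ((∑ i, (k i : ℝ) * αs i : ℝ) : ℂ))).im ≠ 0 := by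
    intro r k hr hk h
    rw [Complex.im_ofReal_mul, mul_comm Complex.I, Complex.exp_ofReal_mul_I_im] at h
    obtain ⟨m, hm⟩ := Real.sin_eq_zero_iff.1 ((mul_eq_zero.1 h).resolve_left hr)
    exact hangles k hk m hm.symm
  have hcim : ∀ i, (c i).im ≠ 0 := by
    intro i
    have h := him (qs i) (Pi.single i 1) (hqs i).1.ne' ⟨i, by simp⟩
    simpa [Pi.single_apply, hcdef] using h
  have hc0 : ∀ i, c i ≠ 0 := fun i h => hcim i (by simp [h])
  have hφinj : ∀ i, Function.Injective (φ i) := by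
    intro i z w h
    have h' := hφsub i z w
    rw [h, right_eq_add, mul_eq_zero] at h'
    exact sub_eq_zero.1 (h'.resolve_left (hc0 i))
  have hφcomb : ∀ i (x y : ℂ) (a b : ℝ), a + b = 1 →
      φ i (a • x + b • y) = a • φ i x + b • φ i y := by
    intro i x y a b hab
    have hab' : (a : ℂ) + b = 1 := by exact_mod_cast hab
    simp only [hφ, Complex.real_smul]
    linear_combination (-(zs i) + (qs i : ℂ) * Complex.exp (Complex.I * (αs i : ℂ)) * zs i) * hab'
  have hφK : ∀ i, ∀ z ∈ K, φ i z ∈ K := by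
    intro i z hz
    rw [hKinv]
    exact mem_iUnion.2 ⟨i, mem_image_of_mem _ hz⟩
  have hφH : ∀ i, ∀ z ∈ convexHull ℝ K, φ i z ∈ convexHull ℝ K := by
    intro i
    refine convexHull_min (t := φ i ⁻¹' convexHull ℝ K)
      (fun z hz => subset_convexHull ℝ K (hφK i z hz)) ?_
    intro x hx y hy a b ha hb hab
    rw [mem_preimage, hφcomb i x y a b hab]
    exact convex_convexHull ℝ K hx hy ha hb hab
  have hφO : ∀ i, ∀ z ∈ O, φ i z ∈ O := fun i z hz =>
    hOsub (mem_iUnion.2 ⟨i, mem_image_of_mem _ hz⟩)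
  have hnontriv : ∀ v, ∃ x ∈ convexHull ℝ K, x ≠ v := by
    intro v
    by_contra! hall
    have hfix : ∀ i, φ i v = v := by
      obtain ⟨x, hx⟩ := hKne
      intro i
      have h := hφH i x (subset_convexHull ℝ K hx)
      rw [hall x (subset_convexHull ℝ K hx)] at h
      exact hall _ h
    have hvO : v ∈ O := by
      obtain ⟨y, hy, hv⟩ := hOconv.exists_mem_openSegment_of_similitude (v := v)
        (hcim ⟨0, by omega⟩)
        (fun z hz => by
          have h := hφO ⟨0, by omega⟩ z hz
          rwa [hφsub _ z v, hfix] at h) ho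
      exact hOconv.openSegment_subset ho hy hv
    have hmem : v ∈ φ ⟨0, by omega⟩ '' O ∩ φ ⟨1, by omega⟩ '' O :=
      ⟨⟨v, hvO, hfix _⟩, ⟨v, hvO, hfix _⟩⟩
    rw [hOdisj _ _ (by simp)] at hmem
    exact hmem
  have hpred : ∀ v : extremePoints ℝ (convexHull ℝ K),
      ∃ (i : Fin n) (y : extremePoints ℝ (convexHull ℝ K)), φ i y = v := by
    rintro ⟨v, hv⟩
    have hvK : v ∈ K := extremePoints_convexHull_subset hv
    rw [hKinv] at hvK
    obtain ⟨i, y, hy, hyv⟩ := mem_iUnion.1 hvK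
    refine ⟨i, ⟨y, mem_extremePoints.2 ⟨subset_convexHull ℝ K hy, ?_⟩⟩, hyv⟩
    rintro x₁ hx₁ x₂ hx₂ ⟨a, b, ha, hb, hab, hy'⟩
    have hseg : v ∈ openSegment ℝ (φ i x₁) (φ i x₂) :=
      ⟨a, b, ha, hb, hab, by rw [← hφcomb i x₁ x₂ a b hab, hy', hyv]⟩
    have h := (mem_extremePoints.1 hv).2 _ (hφH i x₁ hx₁) _ (hφH i x₂ hx₂) hseg
    exact ⟨hφinj i (h.1.trans hyv.symm), hφinj i (h.2.trans hyv.symm)⟩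
  choose g f hgf using hpred
  have hiter : ∀ (p : ℕ) (v : extremePoints ℝ (convexHull ℝ K)),
      ∃ (r : ℝ) (k : Fin n → ℕ), r ≠ 0 ∧ ∑ i, k i = p ∧ ∀ z ∈ convexHull ℝ K,
        (r : ℂ) * Complex.exp (Complex.I * ((∑ i, (k i : ℝ) * αs i : ℝ) : ℂ))
          * (z - (f^[p] v : extremePoints ℝ (convexHull ℝ K))) + v ∈ convexHull ℝ K := by
    intro p
    induction p with
    | zero => exact fun v => ⟨1, 0, one_ne_zero, by simp, fun z hz => by simpa using hz⟩
    | succ p ih =>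
      intro v
      obtain ⟨r, k, hr, hk, hmaps⟩ := ih (f v)
      refine ⟨qs (g v) * r, Pi.single (g v) 1 + k, mul_ne_zero (hqs _).1.ne' hr, ?_, ?_⟩
      · simp [Finset.sum_add_distrib, hk, add_comm]
      · intro z hz
        have h := hφH (g v) _ (hmaps z hz)
        rw [hφsub _ _ (f v), hgf] at h
        have hsum : ∑ i, (((Pi.single (g v) 1 + k : Fin n → ℕ) i : ℕ) : ℝ) * αs i
            = αs (g v) + ∑ i, (k i : ℝ) * αs i := by
          simp [add_mul, Finset.sum_add_distrib, Pi.single_apply]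
        rw [hsum, Function.iterate_succ_apply]
        convert h using 1
        simp only [hcdef]
        rw [Complex.ofReal_add, mul_add, Complex.exp_add, Complex.ofReal_mul]
        ring
  intro hfin
  have : Finite (extremePoints ℝ (convexHull ℝ K)) := hfin
  obtain ⟨v₀, hv₀⟩ : (extremePoints ℝ (convexHull ℝ K)).Nonempty :=
    hKc.extremePoints_convexHull_nonempty hKne
  obtain ⟨a, b, hab, heq⟩ :=
    Finite.exists_ne_map_eq_of_infinite fun m : ℕ => f^[m] ⟨v₀, hv₀⟩
  obtain ⟨v, p, hp, hvp⟩ :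
      ∃ (v : extremePoints ℝ (convexHull ℝ K)) (p : ℕ), p ≠ 0 ∧ f^[p] v = v := by
    wlog hlt : a < b generalizing a b
    · exact this b a hab.symm heq.symm (by omega)
    · refine ⟨f^[a] ⟨v₀, hv₀⟩, b - a, by omega, ?_⟩
      rw [← Function.iterate_add_apply, Nat.sub_add_cancel hlt.le]
      exact heq.symm
  obtain ⟨r, k, hr, hk, hmaps⟩ := hiter p v
  rw [hvp] at hmaps
  have hk0 : ∃ i, k i ≠ 0 := by
    by_contra! h
    exact hp (by simp [← hk, h])
  obtain ⟨x, hx, hxv⟩ := hnontriv v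
  obtain ⟨y, hy, hvy⟩ := (convex_convexHull ℝ K).exists_mem_openSegment_of_similitude
    (him r k hr hk0) hmaps hx
  exact hxv ((mem_extremePoints.1 v.2).2 x hx y hy hvy).1
end

section
/- Suppose the system (φ₁,…,φₙ) satisfies the open convex set condition. Then the set F of extreme points of K̃ = convexHull ℝ K has Hausdorff dimension zero: dimH(extremePoints ℝ K̃) = 0. -/
open Set MeasureTheory
open Filter Topology

/-- The convex hull of a compact set in a finite-dimensional space is compact. -/
theorem IsCompact.convexHull_of_finiteDimensional {E : Type*} [NormedAddCommGroup E]
    [NormedSpace ℝ E] [FiniteDimensional ℝ E] {s : Set E} (hs : IsCompact s) :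
    IsCompact (convexHull ℝ s) := by
  obtain rfl | ⟨s₀, hs₀⟩ := s.eq_empty_or_nonempty
  · simp
  set N := Module.finrank ℝ E + 1
  have key : convexHull ℝ s =
      (fun p : (Fin N → E) × (Fin N → ℝ) => ∑ i, p.2 i • p.1 i) ''
        ((univ.pi fun _ => s) ×ˢ stdSimplex ℝ (Fin N)) := by
    apply Subset.antisymm
    · intro x hx
      obtain ⟨ι, _, z, w, hz, hind, hw, hw1, rfl⟩ := eq_pos_convex_span_of_mem_convexHull hx
      have hcard : Fintype.card ι ≤ Fintype.card (Fin N) := by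
        rw [Fintype.card_fin]
        exact hind.card_le_finrank_succ.trans (Nat.succ_le_succ (Submodule.finrank_le _))
      obtain ⟨e⟩ := Function.Embedding.nonempty_of_card_le hcard
      have hout : ∀ i, i ∉ range e → Function.extend e w 0 i = 0 := fun i hi => by
        rw [Function.extend_apply' _ _ _ (by simpa using hi)]; rfl
      refine ⟨(Function.extend e z fun _ => s₀, Function.extend e w 0), ⟨fun i _ => ?_, ?_, ?_⟩, ?_⟩
      · by_cases hi : i ∈ range e
        · obtain ⟨j, rfl⟩ := hi
          simpa [e.injective.extend_apply] using hz (mem_range_self j)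
        · simpa [Function.extend_apply' _ _ _ (show ¬ ∃ a, e a = i by simpa using hi)] using hs₀
      · intro i
        by_cases hi : i ∈ range e
        · obtain ⟨j, rfl⟩ := hi
          simpa [e.injective.extend_apply] using (hw j).le
        · exact (hout i hi).ge
      · rw [← hw1]
        exact (Fintype.sum_of_injective e e.injective _ _ hout
          fun i => (e.injective.extend_apply _ _ _).symm).symm
      · refine (Fintype.sum_of_injective e e.injective _ _ (fun i hi => ?_) fun i => ?_).symm
        · simp [hout i hi]
        · simp [e.injective.extend_apply]
    · rintro _ ⟨⟨z, w⟩, ⟨hz, hw0, hw1⟩, rfl⟩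
      exact (convex_convexHull ℝ s).sum_mem (fun i _ => hw0 i) hw1
        fun i _ => subset_convexHull ℝ s (hz i (mem_univ i))
  rw [key]
  refine ((isCompact_univ_pi fun _ => hs).prod (isCompact_stdSimplex ℝ _)).image ?_
  fun_prop

/-- The coordinate of `z` in the direction `exp (iθ)`. -/
noncomputable def dirCoord (θ : ℝ) (z : ℂ) : ℝ := z.re * Real.cos θ + z.im * Real.sin θ

theorem dirCoord_similarity (θ ρ α : ℝ) (b z : ℂ) :
    dirCoord θ ((ρ : ℂ) * Complex.exp (Complex.I * (α : ℂ)) * z + b) =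
      ρ * dirCoord (θ - α) z + dirCoord θ b := by
  rw [mul_comm Complex.I, Complex.exp_mul_I, ← Complex.ofReal_cos, ← Complex.ofReal_sin]
  simp only [dirCoord, Real.cos_sub, Real.sin_sub, Complex.add_re, Complex.add_im, Complex.mul_re,
    Complex.mul_im, Complex.ofReal_re, Complex.ofReal_im, Complex.I_re, Complex.I_im]
  ring

theorem exists_dirCoord_eq (f : StrongDual ℝ ℂ) :
    ∃ r β : ℝ, 0 ≤ r ∧ ∀ z, f z = r * dirCoord β z := by
  refine ⟨‖(⟨f 1, f Complex.I⟩ : ℂ)‖, Complex.arg ⟨f 1, f Complex.I⟩, norm_nonneg _, fun z => ?_⟩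
  have h : f z = z.re * f 1 + z.im * f Complex.I := by
    conv_lhs => rw [← Complex.re_add_im z, map_add]
    have h₁ : (z.re : ℂ) = z.re • (1 : ℂ) := by simp
    have h₂ : (z.im : ℂ) * Complex.I = z.im • Complex.I := by simp
    rw [h₁, h₂, map_smul, map_smul, smul_eq_mul, smul_eq_mul]
  have hc := Complex.norm_mul_cos_arg ⟨f 1, f Complex.I⟩
  have hs := Complex.norm_mul_sin_arg ⟨f 1, f Complex.I⟩
  simp only at hc hs
  rw [h, dirCoord]
  linear_combination -z.re * hc - z.im * hs

/-- `A` reaches at least as far as `B` in the direction `exp (iθ)`. -/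
def Dominates (A B : Set ℂ) (θ : ℝ) : Prop :=
  ∀ x ∈ B, ∃ y ∈ A, dirCoord θ x ≤ dirCoord θ y

theorem Dominates.trans {A B C : Set ℂ} {θ : ℝ} (h₁ : Dominates A B θ) (h₂ : Dominates B C θ) :
    Dominates A C θ := fun x hx => by
  obtain ⟨y, hy, hxy⟩ := h₂ x hx
  obtain ⟨z, hz, hyz⟩ := h₁ y hy
  exact ⟨z, hz, hxy.trans hyz⟩

theorem Dominates.total (A B : Set ℂ) (θ : ℝ) : Dominates A B θ ∨ Dominates B A θ := by
  by_contra! h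
  obtain ⟨h₁, h₂⟩ := h
  simp only [Dominates, not_forall, not_exists, not_and, not_le] at h₁
  obtain ⟨x, hx, hxA⟩ := h₁
  exact h₂ fun y hy => ⟨x, hx, (hxA y hy).le⟩

theorem eventually_sin_sign (a s : ℝ) :
    (∀ᶠ t in 𝓝[>] (0 : ℝ), 0 < Real.sin (a + s * t)) ∨
    (∀ᶠ t in 𝓝[>] (0 : ℝ), Real.sin (a + s * t) < 0) ∨ s = 0 := by
  have hcont : ∀ c : ℝ, Tendsto (fun t : ℝ => Real.sin (c + s * t)) (𝓝[>] 0) (𝓝 (Real.sin c)) := by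
    intro c
    have h : Continuous fun t : ℝ => Real.sin (c + s * t) := by fun_prop
    simpa using (h.tendsto 0).mono_left nhdsWithin_le_nhds
  have hcont' : Tendsto (fun t : ℝ => s * t) (𝓝[>] 0) (𝓝 0) := by
    have h : Continuous fun t : ℝ => s * t := by fun_prop
    simpa using (h.tendsto 0).mono_left nhdsWithin_le_nhds
  have hpos : ∀ᶠ t in 𝓝[>] (0 : ℝ), 0 < t := self_mem_nhdsWithin
  have hsmall : ∀ᶠ t in 𝓝[>] (0 : ℝ), s * t ∈ Ioo (-Real.pi) Real.pi :=
    hcont' (Ioo_mem_nhds (by linarith [Real.pi_pos]) Real.pi_pos)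
  rcases lt_trichotomy (Real.sin a) 0 with h | h | h
  · exact Or.inr (Or.inl ((hcont a).eventually_lt_const h))
  · have hadd : ∀ t, Real.sin (a + s * t) = Real.cos a * Real.sin (s * t) := fun t => by
      rw [Real.sin_add, h]; ring
    have hca : Real.cos a = 1 ∨ Real.cos a = -1 := Real.sin_eq_zero_iff_cos_eq.1 h
    simp only [hadd]
    rcases lt_trichotomy s 0 with hs | hs | hs
    · have hneg : ∀ᶠ t in 𝓝[>] (0 : ℝ), Real.sin (s * t) < 0 := by
        filter_upwards [hpos, hsmall] with t ht ht'
        exact Real.sin_neg_of_neg_of_neg_pi_lt (mul_neg_of_neg_of_pos hs ht) ht'.1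
      rcases hca with hc | hc <;> rw [hc]
      · exact Or.inr (Or.inl (hneg.mono fun t ht => by linarith))
      · exact Or.inl (hneg.mono fun t ht => by linarith)
    · exact Or.inr (Or.inr hs)
    · have hp : ∀ᶠ t in 𝓝[>] (0 : ℝ), 0 < Real.sin (s * t) := by
        filter_upwards [hpos, hsmall] with t ht ht'
        exact Real.sin_pos_of_pos_of_lt_pi (mul_pos hs ht) ht'.2
      rcases hca with hc | hc <;> rw [hc]
      · exact Or.inl (hp.mono fun t ht => by linarith)
      · exact Or.inr (Or.inl (hp.mono fun t ht => by linarith))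
  · exact Or.inl ((hcont a).eventually_const_lt h)

theorem dirCoord_combination (β ψ ψ' : ℝ) (z : ℂ) :
    Real.sin ψ' * dirCoord (β + ψ) z =
      Real.sin ψ * dirCoord (β + ψ') z + Real.sin (ψ' - ψ) * dirCoord β z := by
  simp only [dirCoord, Real.cos_add, Real.sin_add, Real.sin_sub]
  ring

/-- Domination propagates towards directions in which the separation favours the dominating set. -/
theorem Dominates.of_separated {A B : Set ℂ} {β c ψ ψ' : ℝ}
    (hA : ∀ x ∈ A, dirCoord β x ≤ c) (hB : ∀ x ∈ B, c ≤ dirCoord β x)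
    (hψ : 0 < Real.sin ψ) (hψ' : 0 < Real.sin ψ') (hd : Real.sin (ψ' - ψ) ≤ 0)
    (h : Dominates A B (β + ψ')) : Dominates A B (β + ψ) := fun x hx => by
  obtain ⟨y, hy, hxy⟩ := h x hx
  refine ⟨y, hy, le_of_mul_le_mul_left ?_ hψ'⟩
  rw [dirCoord_combination β ψ ψ' x, dirCoord_combination β ψ ψ' y]
  have h₁ := mul_le_mul_of_nonneg_left hxy hψ.le
  have h₂ := mul_le_mul_of_nonpos_left ((hA y hy).trans (hB x hx)) hd
  linarith

/-- The counterpart of `Dominates.of_separated` for the set on the other side of the line. -/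
theorem Dominates.of_separated' {A B : Set ℂ} {β c ψ ψ' : ℝ}
    (hA : ∀ x ∈ A, dirCoord β x ≤ c) (hB : ∀ x ∈ B, c ≤ dirCoord β x)
    (hψ : 0 < Real.sin ψ) (hψ' : 0 < Real.sin ψ') (hd : 0 ≤ Real.sin (ψ' - ψ))
    (h : Dominates B A (β + ψ')) : Dominates B A (β + ψ) := fun x hx => by
  obtain ⟨y, hy, hxy⟩ := h x hx
  refine ⟨y, hy, le_of_mul_le_mul_left ?_ hψ'⟩
  rw [dirCoord_combination β ψ ψ' x, dirCoord_combination β ψ ψ' y]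
  have h₁ := mul_le_mul_of_nonneg_left hxy hψ.le
  have h₂ := mul_le_mul_of_nonneg_left ((hA x hx).trans (hB y hy)) hd
  linarith

/-- If domination propagates from a parameter to all smaller ones, one of two sets dominates
throughout some interval to the right of `0`. -/
theorem eventually_dominates_of_propagates {A B : Set ℂ} {u : ℝ → ℝ} {ε : ℝ} (hε : 0 < ε)
    (h : ∀ t t', 0 < t → t < t' → t' < ε → Dominates A B (u t') → Dominates A B (u t)) :
    (∀ᶠ t in 𝓝[>] (0 : ℝ), Dominates A B (u t)) ∨
      ∀ᶠ t in 𝓝[>] (0 : ℝ), Dominates B A (u t) := by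
  by_cases hex : ∃ t', 0 < t' ∧ t' < ε ∧ Dominates A B (u t')
  · obtain ⟨t', h0, h1, hD⟩ := hex
    refine Or.inl ?_
    filter_upwards [Ioo_mem_nhdsGT h0] with t ht
    exact h t t' ht.1 ht.2 h1 hD
  · push Not at hex
    refine Or.inr ?_
    filter_upwards [Ioo_mem_nhdsGT hε] with t ht
    exact (Dominates.total A B _).resolve_left (hex t ht.1 ht.2)

theorem eventually_dominates_of_sin_pos {A B : Set ℂ} {β c : ℝ}
    (hA : ∀ x ∈ A, dirCoord β x ≤ c) (hB : ∀ x ∈ B, c ≤ dirCoord β x) (ψ s : ℝ)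
    (hsin : ∀ᶠ t in 𝓝[>] (0 : ℝ), 0 < Real.sin (ψ + s * t)) :
    (∀ᶠ t in 𝓝[>] (0 : ℝ), Dominates A B (β + (ψ + s * t))) ∨
      ∀ᶠ t in 𝓝[>] (0 : ℝ), Dominates B A (β + (ψ + s * t)) := by
  have hcont : Tendsto (fun t : ℝ => s * t) (𝓝[>] 0) (𝓝 0) := by
    have h : Continuous fun t : ℝ => s * t := by fun_prop
    simpa using (h.tendsto 0).mono_left nhdsWithin_le_nhds
  have hsmall : ∀ᶠ t in 𝓝[>] (0 : ℝ), |s * t| < Real.pi := by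
    filter_upwards [hcont (Ioo_mem_nhds (neg_lt_zero.2 Real.pi_pos) Real.pi_pos)] with t ht
    exact abs_lt.2 ht
  obtain ⟨ε, hε, hεs⟩ := mem_nhdsGT_iff_exists_Ioo_subset.1 (hsin.and hsmall)
  rw [mem_Ioi] at hε
  have hdiff : ∀ t t', (ψ + s * t') - (ψ + s * t) = s * (t' - t) := fun t t' => by ring
  have hbd : ∀ t t', 0 < t → t < t' → t' < ε → |s * (t' - t)| < Real.pi := by
    intro t t' h0 h1 h2
    refine lt_of_le_of_lt ?_ (hεs ⟨h0.trans h1, h2⟩).2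
    rw [abs_mul, abs_mul, abs_of_pos (sub_pos.2 h1), abs_of_pos (h0.trans h1)]
    gcongr
    linarith
  rcases le_total s 0 with hs | hs
  · refine eventually_dominates_of_propagates hε fun t t' h0 h1 h2 hD => ?_
    refine hD.of_separated hA hB (hεs ⟨h0, h1.trans h2⟩).1 (hεs ⟨h0.trans h1, h2⟩).1 ?_
    rw [hdiff]
    exact Real.sin_nonpos_of_nonpos_of_neg_pi_le
      (mul_nonpos_of_nonpos_of_nonneg hs (by linarith)) (abs_lt.1 (hbd t t' h0 h1 h2)).1.le
  · refine (eventually_dominates_of_propagates hε fun t t' h0 h1 h2 hD => ?_).symm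
    refine hD.of_separated' hA hB (hεs ⟨h0, h1.trans h2⟩).1 (hεs ⟨h0.trans h1, h2⟩).1 ?_
    rw [hdiff]
    exact Real.sin_nonneg_of_nonneg_of_le_pi
      (mul_nonneg hs (by linarith)) (abs_lt.1 (hbd t t' h0 h1 h2)).2.le

theorem eventually_dominates {A B : Set ℂ} {β c : ℝ}
    (hA : ∀ x ∈ A, dirCoord β x ≤ c) (hB : ∀ x ∈ B, c ≤ dirCoord β x) (θ s : ℝ) :
    (∀ᶠ t in 𝓝[>] (0 : ℝ), Dominates A B (θ + s * t)) ∨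
      ∀ᶠ t in 𝓝[>] (0 : ℝ), Dominates B A (θ + s * t) := by
  rcases eventually_sin_sign (θ - β) s with h | h | rfl
  · simpa only [show ∀ t, β + (θ - β + s * t) = θ + s * t from fun t => by ring]
      using eventually_dominates_of_sin_pos hA hB (θ - β) s h
  · have hneg : ∀ z, dirCoord (β + Real.pi) z = -dirCoord β z := fun z => by
      simp only [dirCoord, Real.cos_add_pi, Real.sin_add_pi]; ring
    have h' : ∀ᶠ t in 𝓝[>] (0 : ℝ), 0 < Real.sin ((θ - β - Real.pi) + s * t) := by
      filter_upwards [h] with t ht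
      rw [show (θ - β - Real.pi) + s * t = (θ - β + s * t) - Real.pi by ring, Real.sin_sub_pi]
      linarith
    rw [or_comm]
    simpa only [show ∀ t, β + Real.pi + (θ - β - Real.pi + s * t) = θ + s * t from
        fun t => by ring]
      using eventually_dominates_of_sin_pos (A := B) (B := A) (β := β + Real.pi) (c := -c)
        (fun x hx => by rw [hneg]; linarith [hB x hx])
        (fun x hx => by rw [hneg]; linarith [hA x hx]) (θ - β - Real.pi) s h'
  · rcases Dominates.total A B θ with h | h
    · exact Or.inl (Eventually.of_forall fun t => by simpa using h)
    · exact Or.inr (Eventually.of_forall fun t => by simpa using h)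

/-- `f` is a direct similitude of ratio at most `r` mapping `K` into itself. -/
def IsSimilarPiece (K : Set ℂ) (r : ℝ) (f : ℂ → ℂ) : Prop :=
  MapsTo f K K ∧ ∃ (ρ α : ℝ) (b : ℂ), 0 < ρ ∧ ρ ≤ r ∧
    ∀ z, f z = (ρ : ℂ) * Complex.exp (Complex.I * (α : ℂ)) * z + b

theorem IsSimilarPiece.id (K : Set ℂ) : IsSimilarPiece K 1 id :=
  ⟨mapsTo_id K, 1, 0, 0, one_pos, le_rfl, fun z => by simp⟩

theorem IsSimilarPiece.comp {K : Set ℂ} {r s : ℝ} {f g : ℂ → ℂ} (hf : IsSimilarPiece K r f)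
    (hg : IsSimilarPiece K s g) : IsSimilarPiece K (r * s) (f ∘ g) := by
  obtain ⟨hfK, ρ, α, b, hρ, hρr, hfe⟩ := hf
  obtain ⟨hgK, σ, γ, c, hσ, hσs, hge⟩ := hg
  refine ⟨hfK.comp hgK, ρ * σ, α + γ,
    (ρ : ℂ) * Complex.exp (Complex.I * (α : ℂ)) * c + b, mul_pos hρ hσ,
    mul_le_mul hρr hσs hσ.le (hρ.le.trans hρr), fun z => ?_⟩
  rw [Function.comp_apply, hfe, hge]
  push_cast
  rw [mul_add Complex.I, Complex.exp_add]
  ring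

theorem IsSimilarPiece.exists_dominates_comp {K : Set ℂ} {r : ℝ} {f : ℂ → ℂ}
    (hf : IsSimilarPiece K r f) :
    ∃ α : ℝ, ∀ (g : ℂ → ℂ) (θ : ℝ), Dominates (f '' K) K θ → Dominates (g '' K) K (θ - α) →
      Dominates ((f ∘ g) '' K) K θ := by
  obtain ⟨-, ρ, α, b, hρ, -, hfe⟩ := hf
  refine ⟨α, fun g θ h₁ h₂ x hx => ?_⟩
  obtain ⟨_, ⟨y, hy, rfl⟩, hxy⟩ := h₁ x hx
  obtain ⟨_, ⟨z, hz, rfl⟩, hyz⟩ := h₂ y hy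
  refine ⟨f (g z), ⟨z, hz, rfl⟩, hxy.trans ?_⟩
  rw [hfe, hfe, dirCoord_similarity, dirCoord_similarity]
  gcongr

theorem IsSimilarPiece.continuous {K : Set ℂ} {r : ℝ} {f : ℂ → ℂ} (hf : IsSimilarPiece K r f) :
    Continuous f := by
  obtain ⟨-, ρ, α, b, -, -, hfe⟩ := hf
  rw [funext hfe]
  fun_prop

theorem IsSimilarPiece.ediam_image_le {K : Set ℂ} {r : ℝ} {f : ℂ → ℂ} (hf : IsSimilarPiece K r f)
    (hK : Bornology.IsBounded K) :
    Metric.ediam (f '' K) ≤ ENNReal.ofReal (r * Metric.diam K) := by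
  obtain ⟨-, ρ, α, b, hρ, hρr, hfe⟩ := hf
  refine Metric.ediam_le ?_
  rintro _ ⟨x, hx, rfl⟩ _ ⟨y, hy, rfl⟩
  rw [edist_dist]
  refine ENNReal.ofReal_le_ofReal ?_
  have h : f x - f y = (ρ : ℂ) * Complex.exp (Complex.I * (α : ℂ)) * (x - y) := by
    rw [hfe, hfe]; ring
  rw [dist_eq_norm, h, norm_mul, norm_mul, mul_comm Complex.I, Complex.norm_exp_ofReal_mul_I,
    Complex.norm_real, Real.norm_of_nonneg hρ.le, mul_one, ← dist_eq_norm]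
  exact mul_le_mul hρr (Metric.dist_le_diam_of_mem hK hx hy) dist_nonneg (hρ.le.trans hρr)

/-- Near every direction, on the side of it given by `s`, a single piece of ratio at most `r`
dominates `K`. -/
def HasDominatingGerms (K : Set ℂ) (s r : ℝ) : Prop :=
  ∀ θ : ℝ, ∃ f, IsSimilarPiece K r f ∧
    ∀ᶠ t in 𝓝[>] (0 : ℝ), Dominates (f '' K) K (θ + s * t)

theorem HasDominatingGerms.mul {K : Set ℂ} {s r r' : ℝ} (h : HasDominatingGerms K s r)
    (h' : HasDominatingGerms K s r') : HasDominatingGerms K s (r * r') := fun θ => by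
  obtain ⟨f, hf, hfd⟩ := h θ
  obtain ⟨α, hα⟩ := hf.exists_dominates_comp
  obtain ⟨g, hg, hgd⟩ := h' (θ - α)
  refine ⟨f ∘ g, hf.comp hg, ?_⟩
  filter_upwards [hfd, hgd] with t h₁ h₂
  exact hα g _ h₁ (by rwa [show θ + s * t - α = θ - α + s * t by ring])

theorem HasDominatingGerms.pow {K : Set ℂ} {s r : ℝ} (h : HasDominatingGerms K s r) :
    ∀ N : ℕ, HasDominatingGerms K s (r ^ N)
  | 0 => fun θ => ⟨id, by simpa using IsSimilarPiece.id K,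
      Eventually.of_forall fun t x hx => ⟨x, by simpa using hx, le_rfl⟩⟩
  | N + 1 => by rw [pow_succ]; exact (h.pow N).mul h

/-- Over every window of directions of length `δ`, some `k` pieces of ratio at most `r` suffice to
dominate `K`. -/
def HasDominatingLists (K : Set ℂ) (r : ℝ) (k : ℕ) (δ : ℝ) : Prop :=
  ∀ a : ℝ, ∃ L : List (ℂ → ℂ), L.length ≤ k ∧ (∀ f ∈ L, IsSimilarPiece K r f) ∧
    ∀ t ∈ Icc a (a + δ), ∃ f ∈ L, Dominates (f '' K) K t

theorem length_flatMap_le {α β : Type*} (L : List α) (F : α → List β) {k l : ℕ}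
    (hL : L.length ≤ k) (hF : ∀ a, (F a).length ≤ l) : (L.flatMap F).length ≤ k * l := by
  rw [List.length_flatMap]
  refine (List.sum_le_card_nsmul _ l ?_).trans ?_
  · intro x hx
    obtain ⟨a, -, rfl⟩ := List.mem_map.1 hx
    exact hF a
  · rw [List.length_map, smul_eq_mul]
    gcongr

theorem HasDominatingLists.mul {K : Set ℂ} {r r' δ : ℝ} {k l : ℕ}
    (h : HasDominatingLists K r k δ) (h' : HasDominatingLists K r' l δ) :
    HasDominatingLists K (r * r') (k * l) δ := fun a => by
  obtain ⟨L, hLk, hLp, hLd⟩ := h a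
  have step : ∀ f : ℂ → ℂ, ∃ L' : List (ℂ → ℂ), L'.length ≤ l ∧ (IsSimilarPiece K r f →
      (∀ g ∈ L', IsSimilarPiece K (r * r') g) ∧
      ∀ t ∈ Icc a (a + δ), Dominates (f '' K) K t → ∃ g ∈ L', Dominates (g '' K) K t) := by
    intro f
    by_cases hf : IsSimilarPiece K r f
    · obtain ⟨α, hα⟩ := hf.exists_dominates_comp
      obtain ⟨L', hl, hp, hd⟩ := h' (a - α)
      refine ⟨L'.map (f ∘ ·), by simpa using hl, fun _ => ⟨?_, fun t ht hft => ?_⟩⟩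
      · intro g hg
        obtain ⟨g', hg', rfl⟩ := List.mem_map.1 hg
        exact hf.comp (hp g' hg')
      · obtain ⟨g, hg, hgd⟩ := hd (t - α) ⟨by linarith [ht.1], by linarith [ht.2]⟩
        exact ⟨f ∘ g, List.mem_map.2 ⟨g, hg, rfl⟩, hα g t hft hgd⟩
    · exact ⟨[], by simp, fun h => absurd h hf⟩
  choose F hFl hF using step
  refine ⟨L.flatMap F, length_flatMap_le L F hLk hFl, fun g hg => ?_, fun t ht => ?_⟩
  · obtain ⟨f, hf, hgf⟩ := List.mem_flatMap.1 hg
    exact (hF f (hLp f hf)).1 g hgf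
  · obtain ⟨f, hf, hfd⟩ := hLd t ht
    obtain ⟨g, hg, hgd⟩ := (hF f (hLp f hf)).2 t ht hfd
    exact ⟨g, List.mem_flatMap.2 ⟨f, hf, hg⟩, hgd⟩

theorem HasDominatingLists.pow {K : Set ℂ} {r δ : ℝ} {k : ℕ} (h : HasDominatingLists K r k δ) :
    ∀ m : ℕ, HasDominatingLists K (r ^ m) (k ^ m) δ
  | 0 => fun a => ⟨[id], by simp, by simpa using IsSimilarPiece.id K,
      fun t _ => ⟨id, by simp, fun x hx => ⟨x, by simpa using hx, le_rfl⟩⟩⟩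
  | m + 1 => by rw [pow_succ, pow_succ]; exact (h.pow m).mul h

theorem Dominates.add_int_mul_two_pi {A B : Set ℂ} {θ : ℝ} (h : Dominates A B θ) (k : ℤ) :
    Dominates A B (θ + k * (2 * Real.pi)) := fun x hx => by
  obtain ⟨y, hy, hxy⟩ := h x hx
  refine ⟨y, hy, ?_⟩
  simpa only [dirCoord, Real.cos_add_int_mul_two_pi, Real.sin_add_int_mul_two_pi] using hxy

/-- By compactness of the circle, dominating germs on both sides of each direction (and at the
direction itself) give dominating lists of length three over windows of some fixed length. -/
theorem exists_hasDominatingLists {K : Set ℂ} {r : ℝ}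
    (h : ∀ s : ℝ, HasDominatingGerms K s r) : ∃ δ > 0, HasDominatingLists K r 3 δ := by
  have hloc : ∀ θ : ℝ, ∃ ε > 0, ∃ L : List (ℂ → ℂ), L.length ≤ 3 ∧
      (∀ f ∈ L, IsSimilarPiece K r f) ∧
      ∀ t ∈ Metric.ball θ ε, ∃ f ∈ L, Dominates (f '' K) K t := by
    intro θ
    obtain ⟨f, hf, hfd⟩ := h 1 θ
    obtain ⟨g, hg, hgd⟩ := h (-1) θ
    obtain ⟨p, hp, hpd⟩ := h 0 θ
    obtain ⟨ε, hε, hεs⟩ := mem_nhdsGT_iff_exists_Ioo_subset.1 (hfd.and hgd)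
    obtain ⟨_, hpθ⟩ := hpd.exists
    rw [zero_mul, add_zero] at hpθ
    refine ⟨ε, hε, [f, g, p], by simp, by simp [hf, hg, hp], fun t ht => ?_⟩
    rw [Real.ball_eq_Ioo] at ht
    rcases lt_trichotomy t θ with hlt | rfl | hgt
    · have := (hεs (show θ - t ∈ Ioo 0 ε from ⟨by linarith, by linarith [ht.1]⟩)).2
      exact ⟨g, by simp, by simpa using this⟩
    · exact ⟨p, by simp, hpθ⟩
    · have := (hεs (show t - θ ∈ Ioo 0 ε from ⟨by linarith, by linarith [ht.2]⟩)).1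
      exact ⟨f, by simp, by simpa using this⟩
  choose ε hε L hL hLp hLd using hloc
  obtain ⟨δ, hδ, hδs⟩ := lebesgue_number_lemma_of_metric (s := Icc 0 (2 * Real.pi))
    (c := fun θ => Metric.ball θ (ε θ)) isCompact_Icc (fun θ => Metric.isOpen_ball)
    (fun θ _ => mem_iUnion.2 ⟨θ, Metric.mem_ball_self (hε θ)⟩)
  refine ⟨δ / 2, by positivity, fun a => ?_⟩
  have h2π := Real.two_pi_pos
  set a' := toIcoMod h2π 0 a
  have ha' := toIcoMod_mem_Ico h2π 0 a
  have haa' : a = a' + toIcoDiv h2π 0 a * (2 * Real.pi) := by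
    have := toIcoMod_add_toIcoDiv_zsmul h2π 0 a
    rw [zsmul_eq_mul] at this
    exact this.symm
  obtain ⟨θ, hθ⟩ := hδs a' ⟨ha'.1, by linarith [ha'.2]⟩
  refine ⟨L θ, hL θ, hLp θ, fun t ht => ?_⟩
  obtain ⟨f, hf, hfd⟩ := hLd θ (t - toIcoDiv h2π 0 a * (2 * Real.pi)) (hθ (by
    rw [Real.ball_eq_Ioo]
    exact ⟨by linarith [ht.1], by linarith [ht.2]⟩))
  exact ⟨f, hf, by simpa using hfd.add_int_mul_two_pi (toIcoDiv h2π 0 a)⟩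

theorem HasDominatingLists.exists_global {K : Set ℂ} {δ : ℝ} (hδ : 0 < δ) :
    ∃ M : ℕ, ∀ (r : ℝ) (k : ℕ), HasDominatingLists K r k δ →
      ∃ L : List (ℂ → ℂ), L.length ≤ M * k ∧ (∀ f ∈ L, IsSimilarPiece K r f) ∧
        ∀ t : ℝ, ∃ f ∈ L, Dominates (f '' K) K t := by
  have h2π := Real.two_pi_pos
  refine ⟨⌊2 * Real.pi / δ⌋₊ + 1, fun r k h => ?_⟩
  choose F hFl hFp hFd using h
  refine ⟨(List.range (⌊2 * Real.pi / δ⌋₊ + 1)).flatMap fun j : ℕ => F (j * δ),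
    length_flatMap_le _ _ (by simp) fun j => hFl _, fun f hf => ?_, fun t => ?_⟩
  · obtain ⟨j, -, hj⟩ := List.mem_flatMap.1 hf
    exact hFp _ f hj
  · set t' := toIcoMod h2π 0 t
    have ht' : t' ∈ Ico 0 (0 + 2 * Real.pi) := toIcoMod_mem_Ico h2π 0 t
    have htt' : t = t' + toIcoDiv h2π 0 t * (2 * Real.pi) := by
      have := toIcoMod_add_toIcoDiv_zsmul h2π 0 t
      rw [zsmul_eq_mul] at this
      exact this.symm
    have hq : 0 ≤ t' / δ := div_nonneg ht'.1 hδ.le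
    have h₁ : (⌊t' / δ⌋₊ : ℝ) * δ ≤ t' := (le_div_iff₀ hδ).1 (Nat.floor_le hq)
    have h₂ : t' < (⌊t' / δ⌋₊ + 1 : ℝ) * δ := (div_lt_iff₀ hδ).1 (Nat.lt_floor_add_one _)
    obtain ⟨f, hf, hfd⟩ := hFd (⌊t' / δ⌋₊ * δ) t' ⟨h₁, by linarith⟩
    refine ⟨f, List.mem_flatMap.2 ⟨⌊t' / δ⌋₊, ?_, hf⟩, ?_⟩
    · rw [List.mem_range, Nat.lt_succ_iff]
      exact Nat.floor_le_floor (by gcongr; linarith [ht'.2])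
    · rw [htt']
      exact hfd.add_int_mul_two_pi _

/-- A compact subset dominating `K` in every direction contains the extreme points of the convex
hull of `K`. -/
theorem extremePoints_convexHull_subset_of_dominates {K S : Set ℂ} (hS : IsCompact S)
    (hSK : S ⊆ K) (h : ∀ θ, Dominates S K θ) : extremePoints ℝ (convexHull ℝ K) ⊆ S := by
  have hK : convexHull ℝ K = convexHull ℝ S := by
    refine Subset.antisymm (convexHull_min (fun x hx => ?_) (convex_convexHull ℝ S))
      (convexHull_mono hSK)
    by_contra hxS
    obtain ⟨f, u, hfu, hux⟩ := geometric_hahn_banach_closed_point (convex_convexHull ℝ S)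
      hS.convexHull_of_finiteDimensional.isClosed hxS
    obtain ⟨r, β, hr, hf⟩ := exists_dirCoord_eq f
    obtain ⟨y, hy, hxy⟩ := h β x hx
    have h₁ := hfu y (subset_convexHull ℝ S hy)
    have h₂ := mul_le_mul_of_nonneg_left hxy hr
    rw [hf] at h₁ hux
    linarith
  rw [hK]
  exact extremePoints_convexHull_subset

theorem dimH_extremePoints_eq_zero_of_germs {K : Set ℂ} (hK : IsCompact K) {q : ℝ} (hq0 : 0 < q)
    (hq1 : q < 1) (h : ∀ s : ℝ, HasDominatingGerms K s q) :
    dimH (extremePoints ℝ (convexHull ℝ K)) = 0 := by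
  refine le_antisymm (dimH_le fun d hd => ?_) zero_le
  by_contra hd0
  have hdpos : 0 < (d : ℝ) := by
    have : d ≠ 0 := fun h0 => hd0 (by simp [h0])
    exact NNReal.coe_pos.2 (pos_iff_ne_zero.2 this)
  suffices hzero : μH[(d : ℝ)] (extremePoints ℝ (convexHull ℝ K)) ≤ 0 by
    rw [hd] at hzero
    simp at hzero
  obtain ⟨N, hN⟩ : ∃ N : ℕ, (q ^ (d : ℝ)) ^ N < 1 / 3 :=
    exists_pow_lt_of_lt_one (by norm_num) (Real.rpow_lt_one hq0.le hq1 hdpos)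
  have hN0 : N ≠ 0 := by
    rintro rfl
    norm_num at hN
  set r := q ^ N with hr
  have hr0 : 0 < r := pow_pos hq0 N
  have hr1 : r < 1 := pow_lt_one₀ hq0.le hq1 hN0
  have hrd : 3 * r ^ (d : ℝ) < 1 := by
    have : r ^ (d : ℝ) = (q ^ (d : ℝ)) ^ N := by
      rw [hr, ← Real.rpow_natCast, ← Real.rpow_natCast, ← Real.rpow_mul hq0.le,
        ← Real.rpow_mul hq0.le, mul_comm]
    rw [this]
    linarith
  obtain ⟨δ, hδ, hlist⟩ := exists_hasDominatingLists fun s => (h s).pow N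
  obtain ⟨M, hM⟩ := HasDominatingLists.exists_global (K := K) hδ
  choose L hLl hLp hLd using fun m => hM _ _ (hlist.pow m)
  set D := Metric.diam K
  have hD : 0 ≤ D := Metric.diam_nonneg
  have hdiam : ∀ m (i : Fin (L m).length),
      Metric.ediam ((L m).get i '' K) ≤ ENNReal.ofReal (r ^ m * D) := fun m i =>
    (hLp m _ ((L m).get_mem i)).ediam_image_le hK.isBounded
  have hbound := Measure.hausdorffMeasure_le_liminf_sum (ι := fun m => Fin (L m).length) (d : ℝ)
    (extremePoints ℝ (convexHull ℝ K)) (l := atTop) (fun m => ENNReal.ofReal (r ^ m * D)) ?_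
    (fun m i => (L m).get i '' K) (Eventually.of_forall hdiam) (Eventually.of_forall fun m => ?_)
  · refine hbound.trans ?_
    have hle : ∀ m, ∑ i : Fin (L m).length, Metric.ediam ((L m).get i '' K) ^ (d : ℝ) ≤
        ENNReal.ofReal (M * D ^ (d : ℝ) * (3 * r ^ (d : ℝ)) ^ m) := by
      intro m
      calc ∑ i : Fin (L m).length, Metric.ediam ((L m).get i '' K) ^ (d : ℝ)
          ≤ ∑ _i : Fin (L m).length, ENNReal.ofReal ((r ^ m * D) ^ (d : ℝ)) := by
            refine Finset.sum_le_sum fun i _ => ?_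
            rw [← ENNReal.ofReal_rpow_of_nonneg (by positivity) hdpos.le]
            exact ENNReal.rpow_le_rpow (hdiam m i) hdpos.le
        _ = ENNReal.ofReal ((L m).length * (r ^ m * D) ^ (d : ℝ)) := by
            rw [Finset.sum_const, Finset.card_univ, Fintype.card_fin, nsmul_eq_mul,
              ENNReal.ofReal_mul (by positivity), ENNReal.ofReal_natCast]
        _ ≤ _ := by
            refine ENNReal.ofReal_le_ofReal ?_
            have hl : ((L m).length : ℝ) ≤ M * 3 ^ m := by exact_mod_cast hLl m
            have hp : (r ^ m * D) ^ (d : ℝ) = (r ^ (d : ℝ)) ^ m * D ^ (d : ℝ) := by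
              rw [Real.mul_rpow (by positivity) hD, ← Real.rpow_natCast, ← Real.rpow_natCast,
                ← Real.rpow_mul hr0.le, ← Real.rpow_mul hr0.le, mul_comm (m : ℝ)]
            calc ((L m).length : ℝ) * (r ^ m * D) ^ (d : ℝ)
                ≤ (M * 3 ^ m) * (r ^ m * D) ^ (d : ℝ) := by gcongr
              _ = _ := by rw [hp, mul_pow]; ring
    have hlim : Tendsto (fun m : ℕ => ENNReal.ofReal (M * D ^ (d : ℝ) * (3 * r ^ (d : ℝ)) ^ m))
        atTop (𝓝 0) := by
      have := (tendsto_pow_atTop_nhds_zero_of_lt_one (by positivity) hrd).const_mul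
        (M * D ^ (d : ℝ))
      simpa using ENNReal.tendsto_ofReal this
    exact (tendsto_of_tendsto_of_tendsto_of_le_of_le tendsto_const_nhds hlim
      (fun _ => zero_le) hle).liminf_eq.le
  · have := (tendsto_pow_atTop_nhds_zero_of_lt_one hr0.le hr1).mul_const D
    simpa using ENNReal.tendsto_ofReal this
  · refine extremePoints_convexHull_subset_of_dominates ?_ ?_ fun θ x hx => ?_
    · exact isCompact_iUnion fun i => hK.image (hLp m _ ((L m).get_mem i)).continuous
    · exact iUnion_subset fun i => (hLp m _ ((L m).get_mem i)).1.image_subset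
    · obtain ⟨f, hf, hfd⟩ := hLd m θ
      obtain ⟨i, rfl⟩ := List.mem_iff_get.1 hf
      obtain ⟨y, hy, hxy⟩ := hfd x hx
      exact ⟨y, mem_iUnion.2 ⟨i, hy⟩, hxy⟩

/-- The attractor lies in the closure of every nonempty set mapped into itself by the
contractions. -/
theorem subset_closure_of_lipschitz_invariant {ι X : Type*} [PseudoMetricSpace X] {φ : ι → X → X}
    {q : ι → ℝ} (hq : ∀ i, 0 < q i ∧ q i < 1)
    (hφ : ∀ i x y, dist (φ i x) (φ i y) ≤ q i * dist x y) {K O : Set X} (hK : IsCompact K)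
    (hKinv : K ⊆ ⋃ i, φ i '' K) (hO : O.Nonempty) (hOinv : ∀ i, MapsTo (φ i) O O) :
    K ⊆ closure O := by
  intro x hx
  obtain ⟨z, hz, hmax⟩ := hK.exists_isMaxOn ⟨x, hx⟩ (Metric.continuous_infDist_pt O).continuousOn
  obtain ⟨i, y, hy, rfl⟩ := mem_iUnion.1 (hKinv hz)
  have h₁ : Metric.infDist (φ i y) O / q i ≤ Metric.infDist y O :=
    (Metric.le_infDist hO).2 fun w hw => (div_le_iff₀' (hq i).1).2
      ((Metric.infDist_le_dist_of_mem (hOinv i hw)).trans (hφ i y w))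
  rw [div_le_iff₀' (hq i).1] at h₁
  have h₂ : Metric.infDist y O ≤ Metric.infDist (φ i y) O := hmax hy
  have h₃ : Metric.infDist x O ≤ Metric.infDist (φ i y) O := hmax hx
  have h₄ : 0 ≤ Metric.infDist y O := Metric.infDist_nonneg
  have h₅ : 0 ≤ Metric.infDist x O := Metric.infDist_nonneg
  rw [Metric.mem_closure_iff_infDist_zero hO]
  nlinarith [hq i]

/-- Among finitely many sets, pairwise comparable near a filter, one dominates all of them. -/
theorem exists_eventually_dominates {ι κ : Type*} [Finite ι] [Nonempty ι] {A : ι → Set ℂ}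
    {l : Filter κ} {u : κ → ℝ}
    (h : ∀ i j, (∀ᶠ t in l, Dominates (A i) (A j) (u t)) ∨
      ∀ᶠ t in l, Dominates (A j) (A i) (u t)) :
    ∃ i, ∀ᶠ t in l, Dominates (A i) (⋃ j, A j) (u t) := by
  let R : ι → ι → Prop := fun j i => ∀ᶠ t in l, Dominates (A i) (A j) (u t)
  have : IsTrans ι R := ⟨fun a b c hab hbc => by
    filter_upwards [hab, hbc] with t h₁ h₂ using h₂.trans h₁⟩
  have hrefl : ∀ i, R i i := fun i => (h i i).elim (fun h => h) fun h => h
  have hdir : Directed R (fun i : ι => i) := fun i j => (h i j).elim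
    (fun hij => ⟨i, hrefl i, hij⟩) fun hji => ⟨j, hji, hrefl j⟩
  obtain ⟨i, hi⟩ := hdir.finite_le (fun i : ι => i)
  refine ⟨i, ?_⟩
  filter_upwards [eventually_all.2 hi] with t ht x hx
  obtain ⟨j, hj⟩ := mem_iUnion.1 hx
  exact ht j x hj

/-- Theorem 12 (main theorem): if the system satisfies the open convex set condition,
then the set of extreme points of `K̃ = convexHull ℝ K` has Hausdorff dimension zero. -/
theorem extreme_points_dimH_zero
    (n : ℕ) (hn : 2 ≤ n)
    (qs αs : Fin n → ℝ) (zs : Fin n → ℂ)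
    (hqs : ∀ i, 0 < qs i ∧ qs i < 1)
    (φ : Fin n → ℂ → ℂ)
    (hφ : ∀ i z, φ i z = (qs i : ℂ) * Complex.exp (Complex.I * (αs i : ℂ)) * (z - zs i) + zs i)
    (K : Set ℂ) (hKne : K.Nonempty) (hKc : IsCompact K)
    (hKinv : K = ⋃ i, φ i '' K)
    (hOCSC : ∃ O : Set ℂ, O.Nonempty ∧ IsOpen O ∧ Convex ℝ O ∧
      (⋃ i, φ i '' O) ⊆ O ∧ ∀ i j, i ≠ j → φ i '' O ∩ φ j '' O = ∅) :
    dimH (extremePoints ℝ (convexHull ℝ K)) = 0 := by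
  obtain ⟨O, hOne, hOo, hOc, hOinv, hdisj⟩ := hOCSC
  have : Nonempty (Fin n) := ⟨⟨0, by omega⟩⟩
  set c : Fin n → ℂ := fun i => (qs i : ℂ) * Complex.exp (Complex.I * (αs i : ℂ)) with hc
  have hcn : ∀ i, ‖c i‖ = qs i := fun i => by
    rw [hc, norm_mul, mul_comm Complex.I, Complex.norm_exp_ofReal_mul_I, Complex.norm_real,
      Real.norm_of_nonneg (hqs i).1.le, mul_one]
  have hφ' : ∀ i, φ i = fun z => c i * z + (zs i - c i * zs i) := fun i => by
    ext z; rw [hφ]; ring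
  have hc0 : ∀ i, c i ≠ 0 := fun i => norm_ne_zero_iff.1 (by rw [hcn]; exact (hqs i).1.ne')
  have hcont : ∀ i, Continuous (φ i) := fun i => by rw [hφ']; fun_prop
  have hopen : ∀ i, IsOpen (φ i '' O) := fun i => by
    have := ((Homeomorph.mulLeft₀ (c i) (hc0 i)).trans
      (Homeomorph.addRight (zs i - c i * zs i))).isOpenMap O hOo
    rw [hφ']
    exact this
  have hconv : ∀ i, Convex ℝ (φ i '' O) := fun i => by
    have := (hOc.linear_image (LinearMap.mulLeft ℝ (c i))).translate (zs i - c i * zs i)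
    rw [image_image] at this
    rw [hφ']
    simpa [add_comm] using this
  have hKO : K ⊆ closure O := by
    refine subset_closure_of_lipschitz_invariant hqs (fun i x y => ?_) hKc hKinv.subset hOne
      fun i x hx => hOinv (mem_iUnion.2 ⟨i, x, hx, rfl⟩)
    rw [hφ', dist_eq_norm, dist_eq_norm, ← hcn, ← norm_mul]
    exact (congrArg norm (by ring)).le
  have hpieceO : ∀ i, φ i '' K ⊆ closure (φ i '' O) := fun i =>
    (image_mono hKO).trans (image_closure_subset_closure_image (hcont i))
  have hcompare : ∀ (θ s : ℝ) (i j : Fin n),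
      (∀ᶠ t in 𝓝[>] (0 : ℝ), Dominates (φ i '' K) (φ j '' K) (θ + s * t)) ∨
        ∀ᶠ t in 𝓝[>] (0 : ℝ), Dominates (φ j '' K) (φ i '' K) (θ + s * t) := by
    intro θ s i j
    rcases eq_or_ne i j with rfl | hij
    · exact Or.inl (Eventually.of_forall fun t x hx => ⟨x, hx, le_rfl⟩)
    obtain ⟨f, u, hfi, hfj⟩ := geometric_hahn_banach_open (hconv i) (hopen i) (hconv j)
      (disjoint_iff_inter_eq_empty.2 (hdisj i j hij))
    have hfi' : ∀ x ∈ φ i '' K, f x ≤ u := fun x hx =>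
      closure_minimal (fun y hy => (hfi y hy).le)
        (isClosed_le f.continuous continuous_const) (hpieceO i hx)
    have hfj' : ∀ x ∈ φ j '' K, u ≤ f x := fun x hx =>
      closure_minimal (fun y hy => hfj y hy)
        (isClosed_le continuous_const f.continuous) (hpieceO j hx)
    obtain ⟨r, β, hr, hf⟩ := exists_dirCoord_eq f
    have hr0 : 0 < r := by
      refine hr.lt_of_ne fun h0 => ?_
      obtain ⟨o, ho⟩ := hOne
      have h₁ := hfi _ (mem_image_of_mem _ ho)
      have h₂ := hfj _ (mem_image_of_mem _ ho)
      rw [hf, ← h0, zero_mul] at h₁ h₂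
      linarith
    refine eventually_dominates (β := β) (c := u / r) (fun x hx => ?_) (fun x hx => ?_) θ s
    · rw [le_div_iff₀' hr0, ← hf]
      exact hfi' x hx
    · rw [div_le_iff₀' hr0, ← hf]
      exact hfj' x hx
  obtain ⟨m, hm⟩ := Finite.exists_max qs
  refine dimH_extremePoints_eq_zero_of_germs hKc (hqs m).1 (hqs m).2 fun s θ => ?_
  obtain ⟨i, hi⟩ := exists_eventually_dominates (hcompare θ s)
  rw [← hKinv] at hi
  refine ⟨φ i, ⟨fun x hx => ?_, qs i, αs i, zs i - c i * zs i, (hqs i).1, hm i, fun z => ?_⟩, hi⟩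
  · rw [hKinv]
    exact mem_iUnion.2 ⟨i, x, hx, rfl⟩
  · rw [hφ']
end

section
/- Suppose the system (φ₁,…,φₙ) satisfies the open convex set condition and every rotation angle αᵢ is commensurable with π (i.e., αᵢ/π ∈ ℚ for each i). Then K̃ = convexHull ℝ K is a convex polygon: the set extremePoints ℝ K̃ is finite, and K̃ = convexHull ℝ (extremePoints ℝ K̃). -/
open Set

namespace RotationIFS

variable {ι : Type*} {K : Set ℂ} {φ : ι → ℂ → ℂ} {q : ι → ℝ} {ω : ι → ℂ}

/-- The difference of two values of a composition of similitudes, encoded by a word. -/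
theorem foldr_sub_foldr (hφ : ∀ i x y, φ i x - φ i y = q i * ω i * (x - y))
    (w : List ι) (x y : ℂ) :
    w.foldr φ x - w.foldr φ y = ((w.map q).prod : ℝ) * (w.map ω).prod * (x - y) := by
  induction w with
  | nil => simp
  | cons i w ih =>
    simp only [List.foldr_cons, List.map_cons, List.prod_cons, hφ, ih]
    push_cast
    ring

theorem prod_pos (hq : ∀ i, 0 < q i ∧ q i < 1) (w : List ι) : 0 < (w.map q).prod := by
  induction w with
  | nil => simp
  | cons i w ih => simpa using mul_pos (hq i).1 ih

theorem prod_le_one (hq : ∀ i, 0 < q i ∧ q i < 1) (w : List ι) : (w.map q).prod ≤ 1 := by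
  induction w with
  | nil => simp
  | cons i w ih => simpa using mul_le_one₀ (hq i).2.le (prod_pos hq w).le ih

theorem prod_lt_one (hq : ∀ i, 0 < q i ∧ q i < 1) {w : List ι} (hw : w ≠ []) :
    (w.map q).prod < 1 := by
  cases w with
  | nil => exact absurd rfl hw
  | cons i w =>
    simp only [List.map_cons, List.prod_cons]
    nlinarith [hq i, prod_pos hq w, prod_le_one hq w]

theorem prod_pow_eq_one {N : ℕ} (hω : ∀ i, ω i ^ N = 1) (w : List ι) :
    (w.map ω).prod ^ N = 1 := by
  induction w with
  | nil => simp
  | cons i w ih => simp [mul_pow, hω, ih]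

theorem foldr_mem (hK : ∀ i, MapsTo (φ i) K K) (w : List ι) {x : ℂ} (hx : x ∈ K) :
    w.foldr φ x ∈ K := by
  induction w with
  | nil => exact hx
  | cons i w ih => exact hK i ih

/-- The centre of a contracting homothety that preserves a nonempty closed set lies in it. -/
theorem center_mem_of_isClosed {f : ℂ → ℂ} (hKc : IsClosed K) (hf : MapsTo f K K)
    {r : ℝ} (hr0 : 0 ≤ r) (hr1 : r < 1) {p : ℂ} (hp : ∀ z, f z = p + r * (z - p))
    {x : ℂ} (hx : x ∈ K) : p ∈ K := by
  have hiter : ∀ m : ℕ, p + (r : ℂ) ^ m * (x - p) ∈ K := by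
    intro m
    induction m with
    | zero => simpa using hx
    | succ m ih =>
      have := hf ih
      rw [hp] at this
      convert this using 1
      ring
  have hlim : Filter.Tendsto (fun m : ℕ => p + (r : ℂ) ^ m * (x - p)) Filter.atTop
      (nhds (p + 0 * (x - p))) := by
    refine ((tendsto_pow_atTop_nhds_zero_of_norm_lt_one ?_).mul_const _).const_add _
    simpa [abs_of_nonneg hr0] using hr1
  simpa using hKc.mem_of_tendsto hlim (Filter.Eventually.of_forall hiter)

/-- An extreme point of `K` that is the image of a point of `K` under a contracting homothety
preserving `K` is the centre of that homothety. -/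
theorem fixed_of_mem_extremePoints {f : ℂ → ℂ} (hKc : IsClosed K) (hf : MapsTo f K K)
    {r : ℝ} (hr0 : 0 < r) (hr1 : r < 1) (hsub : ∀ x y, f x - f y = r * (x - y))
    {x : ℂ} (hx : x ∈ K) (hfx : f x ∈ extremePoints ℝ K) : f x = x := by
  have hne : (1 - r : ℂ) ≠ 0 := by
    rw [sub_ne_zero]
    exact_mod_cast hr1.ne'
  set p : ℂ := f 0 / (1 - r) with hpdef
  have hp : ∀ z, f z = p + r * (z - p) := by
    intro z
    have h0 : f 0 = p * (1 - r) := by rw [hpdef]; field_simp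
    linear_combination hsub z 0 + h0
  have hpK := center_mem_of_isClosed hKc hf hr0.le hr1 hp hx
  have hseg : f x ∈ openSegment ℝ p x := by
    refine ⟨1 - r, r, by linarith, hr0, by ring, ?_⟩
    rw [hp x]
    simp only [Complex.real_smul]
    push_cast
    ring
  have hpx : p = f x := hfx.2 hpK hx hseg
  have hrc : (r : ℂ) ≠ 0 := by exact_mod_cast hr0.ne'
  have h1 := hp x
  rw [← hpx] at h1
  have h2 : (r : ℂ) * (x - p) = 0 := by linear_combination -h1
  rw [← hpx]
  exact (sub_eq_zero.mp ((mul_eq_zero.mp h2).resolve_left hrc)).symm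

/-- An extreme point of a self-similar set is the image of an extreme point. -/
theorem exists_extreme_preimage (hq : ∀ i, 0 < q i ∧ q i < 1) (hω : ∀ i, ω i ≠ 0)
    (hφ : ∀ i x y, φ i x - φ i y = q i * ω i * (x - y)) (hK : K = ⋃ i, φ i '' K)
    {x : ℂ} (hx : x ∈ extremePoints ℝ K) : ∃ i, ∃ y ∈ extremePoints ℝ K, φ i y = x := by
  have hmaps : ∀ i, MapsTo (φ i) K K := fun i z hz => by
    rw [hK]
    exact mem_iUnion.2 ⟨i, z, hz, rfl⟩
  have hxK := hx.1
  rw [hK] at hxK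
  obtain ⟨i, y, hy, rfl⟩ := mem_iUnion.1 hxK
  refine ⟨i, y, ⟨hy, ?_⟩, rfl⟩
  rintro a ha b hb ⟨s, t, hs, ht, hst, rfl⟩
  have hmem : φ i (s • a + t • b) ∈ openSegment ℝ (φ i a) (φ i b) := by
    refine ⟨s, t, hs, ht, hst, ?_⟩
    have h1 := hφ i a (s • a + t • b)
    have h2 := hφ i b (s • a + t • b)
    have hst' : (s : ℂ) + t = 1 := by exact_mod_cast hst
    simp only [Complex.real_smul] at *
    linear_combination s * h1 + t * h2 +
      (φ i (s * a + t * b) - q i * ω i * (s * a + t * b)) * hst'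
  have heq := hx.2 (hmaps i ha) (hmaps i hb) hmem
  have h := hφ i a (s • a + t • b)
  rw [heq, sub_self] at h
  have hqc : (q i : ℂ) ≠ 0 := by exact_mod_cast (hq i).1.ne'
  exact sub_eq_zero.mp ((mul_eq_zero.mp h.symm).resolve_left (mul_ne_zero hqc (hω i)))

/-- A self-similar set whose rotations have finite order has finitely many extreme points. -/
theorem finite_extremePoints [Finite ι] (hq : ∀ i, 0 < q i ∧ q i < 1)
    {N : ℕ} (hN : 0 < N) (hω : ∀ i, ω i ^ N = 1)
    (hφ : ∀ i x y, φ i x - φ i y = q i * ω i * (x - y))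
    (hKc : IsClosed K) (hK : K = ⋃ i, φ i '' K) : (extremePoints ℝ K).Finite := by
  have hmaps : ∀ i, MapsTo (φ i) K K := fun i z hz => by
    rw [hK]
    exact mem_iUnion.2 ⟨i, z, hz, rfl⟩
  have hω0 : ∀ i, ω i ≠ 0 := fun i h => by
    have := hω i
    rw [h, zero_pow hN.ne'] at this
    exact zero_ne_one this
  set R : Finset ℂ := Polynomial.nthRootsFinset N (1 : ℂ) with hR
  set M := R.card
  have hwords : {w : List ι | w.length ≤ M}.Finite := List.finite_length_le ι M
  have hfix : ∀ v : List ι, v ≠ [] → {p | v.foldr φ p = p}.Finite := by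
    refine fun v hv => Set.Subsingleton.finite fun x hx y hy => ?_
    have h := foldr_sub_foldr hφ v x y
    rw [show v.foldr φ x = x from hx, show v.foldr φ y = y from hy] at h
    by_contra hxy
    have h1 : (((v.map q).prod : ℝ) : ℂ) * (v.map ω).prod = 1 :=
      mul_right_cancel₀ (sub_ne_zero.2 hxy) (by rw [one_mul]; exact h.symm)
    have hnorm : ‖(v.map ω).prod‖ = 1 := Complex.norm_eq_one_of_pow_eq_one (prod_pow_eq_one hω v) hN.ne'
    have h2 := congrArg norm h1
    rw [norm_mul, hnorm, mul_one, norm_one, Complex.norm_real,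
      Real.norm_of_nonneg (prod_pos hq v).le] at h2
    exact (prod_lt_one hq hv).ne h2
  refine Set.Finite.subset (s := ⋃ u ∈ {w : List ι | w.length ≤ M},
      ⋃ v ∈ {w : List ι | w.length ≤ M ∧ w ≠ []}, (u.foldr φ ·) '' {p | v.foldr φ p = p}) ?_ ?_
  · exact hwords.biUnion fun u _ => (hwords.subset fun _ h => h.1).biUnion
      fun v hv => (hfix v hv.2).image _
  intro x hx
  have hstep : ∀ y : extremePoints ℝ K, ∃ i, ∃ z : extremePoints ℝ K, φ i z = y := fun y => by
    obtain ⟨i, z, hz, h⟩ := exists_extreme_preimage hq hω0 hφ hK y.2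
    exact ⟨i, ⟨z, hz⟩, h⟩
  choose I g hIg using hstep
  let y : ℕ → extremePoints ℝ K := fun k => g^[k] ⟨x, hx⟩
  let W : ℕ → ℕ → List ι := fun j m => (List.range' j m).map fun k => I (y k)
  have hW : ∀ m j, (W j m).foldr φ (y (j + m)) = y j := by
    intro m
    induction m with
    | zero => intro j; simp [W]
    | succ m ih =>
      intro j
      have h := ih (j + 1)
      simp only [W, List.range'_succ, List.map_cons, List.foldr_cons] at h ⊢
      rw [show j + (m + 1) = j + 1 + m by ring, h]
      have : y (j + 1) = g (y j) := Function.iterate_succ_apply' g j _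
      rw [this, hIg]
  have hmem : ∀ w : List ι, (w.map ω).prod ∈ R := fun w => by
    rw [hR, Polynomial.mem_nthRootsFinset hN]
    exact prod_pow_eq_one hω w
  obtain ⟨j, k, hjk, hkM, heq⟩ : ∃ j k, j < k ∧ k ≤ M ∧
      ((W 0 j).map ω).prod = ((W 0 k).map ω).prod := by
    obtain ⟨a, ha, b, hb, hab, h⟩ := Finset.exists_ne_map_eq_of_card_lt_of_maps_to
      (s := Finset.range (M + 1)) (t := R) (f := fun k => ((W 0 k).map ω).prod)
      (by simp [M]) (fun k _ => hmem _)
    simp only [Finset.mem_range] at ha hb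
    rcases lt_or_gt_of_ne hab with hlt | hlt
    · exact ⟨a, b, hlt, by omega, h⟩
    · exact ⟨b, a, hlt, by omega, h.symm⟩
  obtain ⟨m, rfl⟩ := Nat.exists_eq_add_of_lt hjk
  have hsplit : W 0 (j + m + 1) = W 0 j ++ W j (m + 1) := by
    simp only [W, ← List.map_append]
    congr 1
    have := List.range'_append (s := 0) (m := j) (n := m + 1) (step := 1)
    simpa [add_assoc] using this.symm
  have hprod : ((W j (m + 1)).map ω).prod = 1 := by
    rw [hsplit, List.map_append, List.prod_append] at heq
    refine mul_left_cancel₀ (a := ((W 0 j).map ω).prod) ?_ (by rw [← heq, mul_one])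
    rw [Ne, List.prod_eq_zero_iff]
    simp [hω0]
  have hv : W j (m + 1) ≠ [] := by simp [W]
  have hfixed := fixed_of_mem_extremePoints (f := fun z => (W j (m + 1)).foldr φ z) hKc
    (fun z hz => foldr_mem hmaps _ hz) (prod_pos hq (W j (m + 1))) (prod_lt_one hq hv)
    (fun a b => by rw [foldr_sub_foldr hφ, hprod, mul_one])
    (y (j + (m + 1))).2.1 (by rw [hW]; exact (y j).2)
  simp only [mem_iUnion]
  refine ⟨W 0 j, by simp [W]; omega, W j (m + 1), ⟨by simp [W]; omega, hv⟩,
    y (j + (m + 1)), hfixed, ?_⟩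
  rw [hW] at hfixed
  rw [← hfixed]
  simpa [y] using hW j 0

/-- A compact set, convex or not, is contained in the closed convex hull of its extreme points. -/
theorem subset_closure_convexHull_extremePoints {S : Set ℂ} (hS : IsCompact S) :
    S ⊆ closure (convexHull ℝ (extremePoints ℝ S)) := by
  by_contra hs
  obtain ⟨x, hxS, hxt⟩ := not_subset.1 hs
  obtain ⟨l, r, hlr, hrx⟩ :=
    geometric_hahn_banach_closed_point (convex_convexHull ℝ _).closure isClosed_closure hxt
  have h : IsExposed ℝ S ({ y ∈ S | ∀ z ∈ S, l z ≤ l y }) := fun _ => ⟨l, rfl⟩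
  obtain ⟨z, hzS, hz⟩ := hS.exists_isMaxOn ⟨x, hxS⟩ l.continuous.continuousOn
  obtain ⟨y, hy⟩ := (h.isCompact hS).extremePoints_nonempty ⟨z, hzS, hz⟩
  linarith [hlr _ (subset_closure <| subset_convexHull ℝ _ <|
    h.isExtreme.extremePoints_subset_extremePoints hy), hy.1.2 x hxS]

theorem exp_pow_eq_one (s : ℚ) :
    Complex.exp (Complex.I * ((s * Real.pi : ℝ) : ℂ)) ^ (2 * s.den) = 1 := by
  rw [← Complex.exp_nat_mul, Complex.exp_eq_one_iff]
  refine ⟨s.num, ?_⟩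
  have h : (s : ℂ) * s.den = s.num := by exact_mod_cast s.mul_den_eq_num
  push_cast
  linear_combination 2 * Complex.I * Real.pi * h

end RotationIFS

/-- Corollary 13: if the system satisfies the open convex set condition and every rotation
angle `αᵢ` is commensurable with `π`, then `K̃ = convexHull ℝ K` is a convex polygon:
its set of extreme points is finite and `K̃` is the convex hull of its extreme points. -/
theorem convexHull_is_polygon_of_commensurable_angles
    (n : ℕ) (hn : 2 ≤ n)
    (qs αs : Fin n → ℝ) (zs : Fin n → ℂ)
    (hqs : ∀ i, 0 < qs i ∧ qs i < 1)
    (φ : Fin n → ℂ → ℂ)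
    (hφ : ∀ i z, φ i z = (qs i : ℂ) * Complex.exp (Complex.I * (αs i : ℂ)) * (z - zs i) + zs i)
    (K : Set ℂ) (hKne : K.Nonempty) (hKc : IsCompact K)
    (hKinv : K = ⋃ i, φ i '' K)
    (hOCSC : ∃ O : Set ℂ, O.Nonempty ∧ IsOpen O ∧ Convex ℝ O ∧
      (⋃ i, φ i '' O) ⊆ O ∧ ∀ i j, i ≠ j → φ i '' O ∩ φ j '' O = ∅)
    (hcomm : ∀ i, ∃ s : ℚ, αs i = (s : ℝ) * Real.pi) :
    (extremePoints ℝ (convexHull ℝ K)).Finite ∧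
      convexHull ℝ K = convexHull ℝ (extremePoints ℝ (convexHull ℝ K)) := by
  choose s hs using hcomm
  have hfinK : (extremePoints ℝ K).Finite := by
    refine RotationIFS.finite_extremePoints (φ := φ) (q := qs)
      (ω := fun i => Complex.exp (Complex.I * (αs i : ℂ))) (N := ∏ i, 2 * (s i).den) hqs
      (Finset.prod_pos fun i _ => by have := (s i).den_pos; omega) (fun i => ?_)
      (fun i x y => by rw [hφ, hφ]; ring) hKc.isClosed hKinv
    obtain ⟨c, hc⟩ := Finset.dvd_prod_of_mem (fun i => 2 * (s i).den) (Finset.mem_univ i)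
    rw [hc, pow_mul, hs, RotationIFS.exp_pow_eq_one, one_pow]
  have hfin : (extremePoints ℝ (convexHull ℝ K)).Finite :=
    hfinK.subset fun x hx => inter_extremePoints_subset_extremePoints_of_subset
      (subset_convexHull ℝ K) ⟨extremePoints_convexHull_subset hx, hx⟩
  refine ⟨hfin, ?_⟩
  have hhull : convexHull ℝ K = convexHull ℝ (extremePoints ℝ K) := by
    refine (convexHull_min ?_ (convex_convexHull ℝ _)).antisymm
      (convexHull_mono extremePoints_subset)
    rw [← (hfinK.isClosed_convexHull ℝ).closure_eq]
    exact RotationIFS.subset_closure_convexHull_extremePoints hKc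
  have hcompact : IsCompact (convexHull ℝ K) := hhull ▸ hfinK.isCompact_convexHull ℝ
  have hKM := closure_convexHull_extremePoints hcompact (convex_convexHull ℝ K)
  rwa [(hfin.isClosed_convexHull ℝ).closure_eq, eq_comm] at hKM
end
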